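/- Let v > 2 and let f₁, f₂, λ ∈ C²(I) on an interval I be such that the Wronskian f₁'(x)f₂''(x) − f₂'(x)f₁''(x) is nonzero for all x ∈ I except possibly on a set of Hausdorff dimension at most 3/(v+1). Then the Hausdorff dimension of A₂(v,λ) is at most 3/(v+1), where A₂(v,λ) is the set of x ∈ I such that ‖a₁f₁(x)+a₂f₂(x)+λ(x)‖ < max(|a₁|,|a₂|)^{−v} for infinitely many (a₁,a₂) ∈ ℤ² \ {0}. -/

import Mathlib

open MeasureTheory Filter Set

/-- Distance from a real number to the nearest integer. -/
noncomputable def nearestIntDist (x : ℝ) : ℝ := |x - round x|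

namespace PlanarDual

/-- The `s`-dimensional Hausdorff content on the real line. -/
noncomputable def hcontent (s : ℝ) (hs : 0 < s) : OuterMeasure ℝ :=
  OuterMeasure.ofFunction (fun U => Metric.ediam U ^ s) (by simp [hs])

lemma hcontent_le_of_dist {s : ℝ} (hs : 0 < s) {U : Set ℝ} {L : ℝ} (hL : 0 ≤ L)
    (h : ∀ x ∈ U, ∀ y ∈ U, |x - y| ≤ L) : hcontent s hs U ≤ ENNReal.ofReal (L ^ s) := by
  refine (OuterMeasure.ofFunction_le U).trans ?_
  rw [← ENNReal.ofReal_rpow_of_nonneg hL hs.le]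
  gcongr
  exact Metric.ediam_le_of_forall_dist_le fun x hx y hy => by simpa [Real.dist_eq] using h x hx y hy

lemma hausdorffMeasure_eq_zero_of_hcontent {s : ℝ} (hs : 0 < s) {S : Set ℝ}
    (h : hcontent s hs S = 0) : μH[s] S = 0 := by
  have key : ∀ n : ℕ, ∃ t : ℕ → Set ℝ, S ⊆ ⋃ i, t i ∧
      ∑' i, Metric.ediam (t i) ^ s < ((n : ENNReal) + 1)⁻¹ := by
    intro n
    have h0 : hcontent s hs S < ((n : ENNReal) + 1)⁻¹ := by
      rw [h]; simp
    rw [hcontent, OuterMeasure.ofFunction_apply] at h0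
    simp only [iInf_lt_iff] at h0
    obtain ⟨t, ht, h1⟩ := h0
    exact ⟨t, ht, h1⟩
  choose t hcov hsum using key
  have hlim : Tendsto (fun n : ℕ => ((n : ENNReal) + 1)⁻¹) atTop (nhds 0) := by
    have := ENNReal.tendsto_inv_nat_nhds_zero
    have h2 := (tendsto_add_atTop_iff_nat 1).2 this
    simpa using h2
  have hr : Tendsto (fun n : ℕ => (((n : ENNReal) + 1)⁻¹) ^ (1 / s)) atTop (nhds 0) := by
    have := hlim.ennrpow_const (1 / s)
    rwa [ENNReal.zero_rpow_of_pos (by positivity)] at this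
  have hle := Measure.hausdorffMeasure_le_liminf_tsum (l := atTop) s S
    (fun n : ℕ => (((n : ENNReal) + 1)⁻¹) ^ (1 / s)) hr t ?_ ?_
  · refine le_antisymm (hle.trans ?_) bot_le
    have h3 : liminf (fun n => ∑' i, Metric.ediam (t n i) ^ s) atTop ≤
        liminf (fun n : ℕ => ((n : ENNReal) + 1)⁻¹) atTop :=
      liminf_le_liminf (Eventually.of_forall fun n => (hsum n).le)
    exact h3.trans hlim.liminf_eq.le
  · refine Eventually.of_forall fun n i => ?_
    have h4 : Metric.ediam (t n i) ^ s ≤ ((n : ENNReal) + 1)⁻¹ :=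
      (ENNReal.le_tsum (f := fun i => Metric.ediam (t n i) ^ s) i).trans (hsum n).le
    calc Metric.ediam (t n i) = (Metric.ediam (t n i) ^ s) ^ (1 / s) := by
          rw [← ENNReal.rpow_mul, mul_one_div_cancel hs.ne', ENNReal.rpow_one]
      _ ≤ _ := by gcongr
  · exact Eventually.of_forall hcov

/-- The Hausdorff contents of the sets `E t` decay exponentially in `t`. -/
def Decay (s : ℝ) (hs : 0 < s) (E : ℕ → Set ℝ) : Prop :=
  ∃ C κ : ℝ, 0 < κ ∧ ∀ᶠ t : ℕ in atTop,
    hcontent s hs (E t) ≤ ENNReal.ofReal (C * (2 : ℝ) ^ (-κ * t))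

lemma Decay.mono {s : ℝ} {hs : 0 < s} {E G : ℕ → Set ℝ} (h : Decay s hs G)
    (hEG : ∀ᶠ t in atTop, E t ⊆ G t) : Decay s hs E := by
  obtain ⟨C, κ, hκ, hG⟩ := h
  refine ⟨C, κ, hκ, ?_⟩
  filter_upwards [hG, hEG] with t h1 h2
  exact (measure_mono h2).trans h1

lemma Decay.union {s : ℝ} {hs : 0 < s} {E G : ℕ → Set ℝ} (hE : Decay s hs E)
    (hG : Decay s hs G) : Decay s hs (fun t => E t ∪ G t) := by
  obtain ⟨C, κ, hκ, hE⟩ := hE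
  obtain ⟨C', κ', hκ', hG⟩ := hG
  refine ⟨|C| + |C'|, min κ κ', lt_min hκ hκ', ?_⟩
  filter_upwards [hE, hG] with t h1 h2
  refine (measure_union_le _ _).trans ?_
  rw [add_mul, ENNReal.ofReal_add (by positivity) (by positivity)]
  refine add_le_add (h1.trans (ENNReal.ofReal_le_ofReal ?_)) (h2.trans (ENNReal.ofReal_le_ofReal ?_))
  · refine mul_le_mul (le_abs_self C) (Real.rpow_le_rpow_of_exponent_le (by norm_num) ?_)
      (by positivity) (by positivity)
    have := min_le_left κ κ'
    nlinarith [(Nat.cast_nonneg t : (0 : ℝ) ≤ t)]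
  · refine mul_le_mul (le_abs_self C') (Real.rpow_le_rpow_of_exponent_le (by norm_num) ?_)
      (by positivity) (by positivity)
    have := min_le_right κ κ'
    nlinarith [(Nat.cast_nonneg t : (0 : ℝ) ≤ t)]

lemma Decay.empty {s : ℝ} {hs : 0 < s} : Decay s hs (fun _ => ∅) :=
  ⟨0, 1, one_pos, by simp⟩

lemma Decay.biUnion_range {s : ℝ} {hs : 0 < s} {E : ℕ → ℕ → Set ℝ} (K : ℕ)
    (h : ∀ k < K, Decay s hs (E k)) : Decay s hs (fun t => ⋃ k < K, E k t) := by
  induction K with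
  | zero => simpa using Decay.empty
  | succ K ih =>
    refine ((ih fun k hk => h k (by omega)).union (h K (by omega))).mono ?_
    refine Eventually.of_forall fun t x hx => ?_
    simp only [mem_iUnion, mem_union] at hx ⊢
    obtain ⟨k, hk, hx⟩ := hx
    rcases Nat.lt_succ_iff_lt_or_eq.1 hk with h1 | rfl
    · exact Or.inl ⟨k, h1, hx⟩
    · exact Or.inr hx

lemma Decay.dimH_le {s : ℝ} {hs : 0 < s} {E : ℕ → Set ℝ} (h : Decay s hs E) :
    dimH {x | ∃ᶠ t in atTop, x ∈ E t} ≤ ENNReal.ofReal s := by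
  obtain ⟨C, κ, hκ, hE⟩ := h
  obtain ⟨t₀, ht₀⟩ := eventually_atTop.1 hE
  have hzero : hcontent s hs {x | ∃ᶠ t in atTop, t₀ ≤ t ∧ x ∈ E t} = 0 := by
    refine measure_setOfPred_frequently_eq_zero (ne_top_of_le_ne_top
      (b := ∑' t : ℕ, ENNReal.ofReal (|C| * ((2 : ℝ) ^ (-κ)) ^ t)) ?_ ?_)
    · have hlt : (2 : ℝ) ^ (-κ) < 1 := Real.rpow_lt_one_of_one_lt_of_neg (by norm_num) (by linarith)
      have hsm : Summable fun t : ℕ => |C| * ((2 : ℝ) ^ (-κ)) ^ t :=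
        (summable_geometric_of_lt_one (by positivity) hlt).mul_left _
      rw [← ENNReal.ofReal_tsum_of_nonneg (fun t => by positivity) hsm]
      exact ENNReal.ofReal_ne_top
    · refine ENNReal.tsum_le_tsum fun t => ?_
      by_cases ht : t₀ ≤ t
      · simp only [ht, true_and]
        refine (ht₀ t ht).trans (ENNReal.ofReal_le_ofReal ?_)
        rw [Real.rpow_mul_natCast (by norm_num)]
        gcongr
        exact le_abs_self C
      · simp [ht]
  have hμ := hausdorffMeasure_eq_zero_of_hcontent hs hzero
  have hset : {x | ∃ᶠ t in atTop, x ∈ E t} ⊆ {x | ∃ᶠ t in atTop, t₀ ≤ t ∧ x ∈ E t} :=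
    fun x hx => ((eventually_ge_atTop t₀).and_frequently hx)
  refine (dimH_mono hset).trans ?_
  have := dimH_le_of_hausdorffMeasure_ne_top (d := s.toNNReal)
    (s := {x | ∃ᶠ t in atTop, t₀ ≤ t ∧ x ∈ E t}) (by
      rw [Real.coe_toNNReal s hs.le, hμ]; simp)
  simpa [ENNReal.ofReal] using this

lemma mul_sub_le_of_le_deriv {F G : ℝ → ℝ} {T : Set ℝ} (hT : T.OrdConnected)
    (hF : ∀ x ∈ T, HasDerivAt F (G x) x) {y : ℝ} (hy : ∀ x ∈ T, y ≤ G x)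
    {x x' : ℝ} (hx : x ∈ T) (hx' : x' ∈ T) (h : x ≤ x') : y * (x' - x) ≤ F x' - F x := by
  rcases h.eq_or_lt with rfl | h
  · simp
  have hsub : Icc x x' ⊆ T := hT.out hx hx'
  obtain ⟨z, hz, hzeq⟩ := exists_hasDerivAt_eq_slope F G h
    (fun z hz => (hF z (hsub hz)).continuousAt.continuousWithinAt)
    (fun z hz => hF z (hsub (Ioo_subset_Icc_self hz)))
  have h1 := hy z (hsub (Ioo_subset_Icc_self hz))
  rw [hzeq, le_div_iff₀ (by linarith)] at h1
  exact h1

lemma mul_abs_sub_le_of_le_deriv {F G : ℝ → ℝ} {T : Set ℝ} (hT : T.OrdConnected)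
    (hF : ∀ x ∈ T, HasDerivAt F (G x) x) {y : ℝ} (hy : ∀ x ∈ T, y ≤ G x)
    {x x' : ℝ} (hx : x ∈ T) (hx' : x' ∈ T) : y * |x - x'| ≤ |F x - F x'| := by
  rcases le_total x x' with h | h
  · rw [abs_sub_comm x x', abs_sub_comm (F x), abs_of_nonneg (sub_nonneg.2 h)]
    exact (mul_sub_le_of_le_deriv hT hF hy hx hx' h).trans (le_abs_self _)
  · rw [abs_of_nonneg (sub_nonneg.2 h)]
    exact (mul_sub_le_of_le_deriv hT hF hy hx' hx h).trans (le_abs_self _)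

lemma abs_sub_le_of_abs_deriv_le {F G : ℝ → ℝ} {T : Set ℝ} (hT : T.OrdConnected)
    (hF : ∀ x ∈ T, HasDerivAt F (G x) x) {M : ℝ} (hM : ∀ x ∈ T, |G x| ≤ M)
    {x x' : ℝ} (hx : x ∈ T) (hx' : x' ∈ T) : |F x - F x'| ≤ M * |x - x'| := by
  have := Convex.norm_image_sub_le_of_norm_hasDerivWithin_le (f := F) (f' := G) (s := T) (C := M)
    (fun z hz => (hF z hz).hasDerivWithinAt) (fun z hz => by simpa using hM z hz)
    hT.convex hx' hx
  simpa using this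

/-- Quadratic lower bound for a function whose second derivative is at least `κ`. -/
lemma taylor_lower {F G K : ℝ → ℝ} {T : Set ℝ} (hT : T.OrdConnected)
    (hF : ∀ x ∈ T, HasDerivAt F (G x) x) (hG : ∀ x ∈ T, HasDerivAt G (K x) x) {κ : ℝ}
    (hK : ∀ x ∈ T, κ ≤ K x) {x y : ℝ} (hx : x ∈ T) (hy : y ∈ T) :
    F y + G y * (x - y) + κ / 2 * (x - y) ^ 2 ≤ F x := by
  have hφ : ∀ z ∈ T, HasDerivAt (fun z => F z - G y * (z - y) - κ / 2 * (z - y) ^ 2)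
      (G z - G y - κ * (z - y)) z := by
    intro z hz
    have h1 : HasDerivAt (fun z : ℝ => z - y) 1 z := (hasDerivAt_id z).sub_const y
    have h2 := ((hF z hz).sub (h1.const_mul (G y))).sub ((h1.pow 2).const_mul (κ / 2))
    exact h2.congr_deriv (by simp; ring)
  have key : ∀ z z' : ℝ, z ∈ T → z' ∈ T → z ≤ z' → κ * (z' - z) ≤ G z' - G z :=
    fun z z' hz hz' h => mul_sub_le_of_le_deriv hT hG hK hz hz' h
  rcases le_total y x with h | h
  · have hsub : Icc y x ⊆ T := hT.out hy hx
    have := mul_sub_le_of_le_deriv (y := 0) (ordConnected_Icc (a := y) (b := x))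
      (fun z hz => hφ z (hsub hz))
      (fun z hz => by linarith [key y z hy (hsub hz) hz.1]) (left_mem_Icc.2 h) (right_mem_Icc.2 h) h
    simp only [sub_self] at this
    nlinarith
  · have hsub : Icc x y ⊆ T := hT.out hx hy
    have := mul_sub_le_of_le_deriv (y := 0) (ordConnected_Icc (a := x) (b := y))
      (fun z hz => (hφ z (hsub hz)).neg)
      (fun z hz => by linarith [key z y (hsub hz) hy hz.2]) (left_mem_Icc.2 h) (right_mem_Icc.2 h) h
    simp only [sub_self, Pi.neg_apply] at this
    nlinarith

lemma int_card_le {A : ℝ} {V : ℝ} (hV : 0 ≤ V) :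
    ((Finset.Icc ⌈A - V⌉ ⌊A + V⌋).card : ℝ) ≤ 2 * V + 1 := by
  rw [Int.card_Icc]
  have h1 : (⌊A + V⌋ : ℝ) ≤ A + V := Int.floor_le _
  have h2 : A - V ≤ (⌈A - V⌉ : ℝ) := Int.le_ceil _
  rcases le_total 0 (⌊A + V⌋ + 1 - ⌈A - V⌉) with h | h
  · have : (((⌊A + V⌋ + 1 - ⌈A - V⌉).toNat : ℤ) : ℝ) = ((⌊A + V⌋ + 1 - ⌈A - V⌉ : ℤ) : ℝ) := by
      rw [Int.toNat_of_nonneg h]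
    rw [Int.cast_natCast] at this
    rw [this]; push_cast; linarith
  · rw [Int.toNat_of_nonpos h]; simp; linarith

lemma hcontent_biUnion_le {s : ℝ} {hs : 0 < s} {ι : Type*} (I : Finset ι) (U : ι → Set ℝ) {B : ℝ}
    (hB : 0 ≤ B) {N : ℝ} (hN : (I.card : ℝ) ≤ N)
    (h : ∀ i ∈ I, hcontent s hs (U i) ≤ ENNReal.ofReal B) :
    hcontent s hs (⋃ i ∈ I, U i) ≤ ENNReal.ofReal (N * B) := by
  refine (measure_biUnion_finset_le I U).trans ((Finset.sum_le_sum h).trans ?_)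
  rw [Finset.sum_const, nsmul_eq_mul, ← ENNReal.ofReal_natCast, ← ENNReal.ofReal_mul (by positivity)]
  exact ENNReal.ofReal_le_ofReal (by gcongr)

lemma hcontent_piece {s : ℝ} {hs : 0 < s} {F G : ℝ → ℝ} {T : Set ℝ} (hT : T.OrdConnected)
    (hF : ∀ x ∈ T, HasDerivAt F (G x) x) {y V δ : ℝ} (hy0 : 0 < y) (hy : ∀ x ∈ T, y ≤ G x)
    (hV0 : 0 ≤ V) (hV : ∀ x ∈ T, ∀ x' ∈ T, |F x - F x'| ≤ V) (hδ0 : 0 < δ) (hδ : δ ≤ 1) :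
    hcontent s hs {x ∈ T | ∃ p : ℤ, |F x - p| < δ} ≤
      ENNReal.ofReal ((2 * (V + 1) + 1) * (2 * δ / y) ^ s) := by
  rcases T.eq_empty_or_nonempty with rfl | ⟨x₀, hx₀⟩
  · simp
  refine (measure_mono (t := ⋃ p ∈ Finset.Icc ⌈F x₀ - (V + 1)⌉ ⌊F x₀ + (V + 1)⌋,
    {x ∈ T | |F x - (p : ℤ)| < δ}) ?_).trans (hcontent_biUnion_le _ _ (by positivity)
      (int_card_le (by positivity)) fun p _ => hcontent_le_of_dist hs (by positivity) ?_)
  · rintro x ⟨hx, p, hp⟩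
    simp only [mem_iUnion, Finset.mem_Icc, exists_prop]
    have h1 := abs_le.1 (hV x hx x₀ hx₀)
    have h2 := abs_lt.1 hp
    exact ⟨p, ⟨Int.ceil_le.2 (by linarith), Int.le_floor.2 (by linarith)⟩, hx, hp⟩
  · rintro x ⟨hx, hxp⟩ x' ⟨hx', hxp'⟩
    have h1 := mul_abs_sub_le_of_le_deriv hT hF hy hx hx'
    rw [le_div_iff₀ hy0, mul_comm]
    refine h1.trans ?_
    have h2 := abs_lt.1 hxp
    have h3 := abs_lt.1 hxp'
    rw [abs_le]; constructor <;> linarith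

/-- The integer vectors whose sup norm lies in `[2 ^ t, 2 ^ (t + 1))`. -/
def Shell (t : ℕ) (a : ℤ × ℤ) : Prop :=
  2 ^ t ≤ max a.1.natAbs a.2.natAbs ∧ max a.1.natAbs a.2.natAbs < 2 ^ (t + 1)

lemma Shell.abs_fst_le {t : ℕ} {a : ℤ × ℤ} (h : Shell t a) : |(a.1 : ℝ)| ≤ 2 * 2 ^ t := by
  have h1 : a.1.natAbs ≤ 2 ^ (t + 1) := (le_max_left _ _).trans h.2.le
  have h2 : ((a.1.natAbs : ℕ) : ℝ) ≤ ((2 ^ (t + 1) : ℕ) : ℝ) := by exact_mod_cast h1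
  rw [Nat.cast_natAbs, Int.cast_abs] at h2
  rw [pow_succ] at h2; push_cast at h2; linarith

lemma Shell.abs_snd_le {t : ℕ} {a : ℤ × ℤ} (h : Shell t a) : |(a.2 : ℝ)| ≤ 2 * 2 ^ t := by
  have h1 : a.2.natAbs ≤ 2 ^ (t + 1) := (le_max_right _ _).trans h.2.le
  have h2 : ((a.2.natAbs : ℕ) : ℝ) ≤ ((2 ^ (t + 1) : ℕ) : ℝ) := by exact_mod_cast h1
  rw [Nat.cast_natAbs, Int.cast_abs] at h2
  rw [pow_succ] at h2; push_cast at h2; linarith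

lemma Shell.le_max {t : ℕ} {a : ℤ × ℤ} (h : Shell t a) :
    (2 : ℝ) ^ t ≤ max |(a.1 : ℝ)| |(a.2 : ℝ)| := by
  have h2 : ((2 ^ t : ℕ) : ℝ) ≤ ((max a.1.natAbs a.2.natAbs : ℕ) : ℝ) := by exact_mod_cast h.1
  rw [Nat.cast_max, Nat.cast_natAbs, Int.cast_abs, Nat.cast_natAbs, Int.cast_abs] at h2
  push_cast at h2; exact h2

lemma Shell.neg {t : ℕ} {a : ℤ × ℤ} (h : Shell t a) : Shell t (-a) := by
  simpa [Shell] using h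

/-- A finite box containing the `t`-th shell. -/
noncomputable def box (t : ℕ) : Finset (ℤ × ℤ) :=
  Finset.Icc (-2 ^ (t + 1)) (2 ^ (t + 1)) ×ˢ Finset.Icc (-2 ^ (t + 1)) (2 ^ (t + 1))

lemma Shell.mem_box {t : ℕ} {a : ℤ × ℤ} (h : Shell t a) : a ∈ box t := by
  have h1 : a.1.natAbs < 2 ^ (t + 1) := (le_max_left _ _).trans_lt h.2
  have h2 : a.2.natAbs < 2 ^ (t + 1) := (le_max_right _ _).trans_lt h.2
  have h1' : ((a.1.natAbs : ℕ) : ℤ) < 2 ^ (t + 1) := by exact_mod_cast h1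
  have h2' : ((a.2.natAbs : ℕ) : ℤ) < 2 ^ (t + 1) := by exact_mod_cast h2
  rw [Int.natCast_natAbs, abs_lt] at h1' h2'
  simp only [box, Finset.mem_product, Finset.mem_Icc]
  exact ⟨⟨h1'.1.le, h1'.2.le⟩, h2'.1.le, h2'.2.le⟩

lemma card_box_le (t : ℕ) : ((box t).card : ℝ) ≤ 25 * ((2 : ℝ) ^ t) ^ 2 := by
  have h1 : ((Finset.Icc (-2 ^ (t + 1) : ℤ) (2 ^ (t + 1))).card : ℝ) ≤ 5 * 2 ^ t := by
    have := int_card_le (A := 0) (V := 2 ^ (t + 1)) (by positivity)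
    have e1 : ⌈(0 : ℝ) - 2 ^ (t + 1)⌉ = -2 ^ (t + 1) := by
      have : (0 : ℝ) - 2 ^ (t + 1) = ((-2 ^ (t + 1) : ℤ) : ℝ) := by push_cast; ring
      rw [this, Int.ceil_intCast]
    have e2 : ⌊(0 : ℝ) + 2 ^ (t + 1)⌋ = 2 ^ (t + 1) := by
      have : (0 : ℝ) + 2 ^ (t + 1) = ((2 ^ (t + 1) : ℤ) : ℝ) := by push_cast; ring
      rw [this, Int.floor_intCast]
    rw [e1, e2] at this
    refine this.trans ?_
    have : (1 : ℝ) ≤ 2 ^ t := one_le_pow₀ (by norm_num)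
    rw [pow_succ]; linarith
  rw [box, Finset.card_product]
  push_cast
  calc _ ≤ (5 * (2 : ℝ) ^ t) * (5 * 2 ^ t) := by gcongr
    _ = _ := by ring

/-- Exponential decay for a union over shells of sets on which the derivative is bounded below. -/
lemma decay_pieces {s : ℝ} {hs : 0 < s} {v β ω c V : ℝ} (hv : 0 < v) (hω : 0 ≤ ω) (hc : 0 < c)
    (hV : 0 ≤ V) (hexp : 2 + ω < (v + β) * s)
    (Φ Γ : ℤ × ℤ → ℝ → ℝ) (T : ℕ → ℤ × ℤ → Set ℝ)
    (hT : ∀ t a, Shell t a → (T t a).OrdConnected)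
    (hder : ∀ t a, Shell t a → ∀ x ∈ T t a, HasDerivAt (Φ a) (Γ a x) x)
    (hlow : ∀ t a, Shell t a → ∀ x ∈ T t a, c * (2 : ℝ) ^ (β * t) ≤ Γ a x)
    (hvar : ∀ t a, Shell t a → ∀ x ∈ T t a, ∀ x' ∈ T t a,
      |Φ a x - Φ a x'| ≤ V * (2 : ℝ) ^ (ω * t)) :
    Decay s hs (fun t => {x | ∃ a, Shell t a ∧ x ∈ T t a ∧
      ∃ p : ℤ, |Φ a x - p| < (2 : ℝ) ^ (-v * t)}) := by
  classical
  refine ⟨25 * ((2 * V + 3) * (2 / c) ^ s), (v + β) * s - 2 - ω, by linarith,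
    Eventually.of_forall fun t => ?_⟩
  refine (measure_mono (t := ⋃ a ∈ (box t).filter (Shell t),
    {x ∈ T t a | ∃ p : ℤ, |Φ a x - p| < (2 : ℝ) ^ (-v * t)}) ?_).trans
      ((hcontent_biUnion_le (N := 25 * ((2 : ℝ) ^ t) ^ 2)
        (B := ((2 * (V * (2 : ℝ) ^ (ω * t) + 1) + 1) *
          (2 * (2 : ℝ) ^ (-v * t) / (c * (2 : ℝ) ^ (β * t))) ^ s)) _ _ (by positivity) ?_ ?_).trans
        (ENNReal.ofReal_le_ofReal ?_))
  · rintro x ⟨a, ha, hx, hp⟩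
    simp only [mem_iUnion, Finset.mem_filter, exists_prop]
    exact ⟨a, ⟨ha.mem_box, ha⟩, hx, hp⟩
  · refine le_trans ?_ (card_box_le t)
    exact_mod_cast Finset.card_filter_le _ _
  · intro a ha
    have ha := (Finset.mem_filter.1 ha).2
    refine hcontent_piece (hT t a ha) (hder t a ha) (by positivity) (hlow t a ha) (by positivity)
      (hvar t a ha) (by positivity) (Real.rpow_le_one_of_one_le_of_nonpos (by norm_num) ?_)
    have : (0 : ℝ) ≤ t := Nat.cast_nonneg t
    nlinarith
  · have h2 : (0 : ℝ) < 2 := by norm_num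
    have ht : (0 : ℝ) ≤ t := Nat.cast_nonneg t
    have e1 : (2 * (2 : ℝ) ^ (-v * t) / (c * (2 : ℝ) ^ (β * t))) ^ s =
        (2 / c) ^ s * (2 : ℝ) ^ (-(v + β) * s * t) := by
      rw [show 2 * (2 : ℝ) ^ (-v * t) / (c * (2 : ℝ) ^ (β * t)) =
        (2 / c) * ((2 : ℝ) ^ (-v * t) / (2 : ℝ) ^ (β * t)) by field_simp, ← Real.rpow_sub h2,
        Real.mul_rpow (by positivity) (by positivity), ← Real.rpow_mul h2.le]
      ring_nf
    have e2 : (1 : ℝ) ≤ (2 : ℝ) ^ (ω * t) := Real.one_le_rpow (by norm_num) (by positivity)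
    have e3 : ((2 : ℝ) ^ t) ^ 2 = (2 : ℝ) ^ (2 * (t : ℝ)) := by
      rw [← Real.rpow_natCast, ← Real.rpow_natCast, ← Real.rpow_mul h2.le]; congr 1; push_cast; ring
    rw [e1, e3]
    calc 25 * (2 : ℝ) ^ (2 * (t : ℝ)) * ((2 * (V * (2 : ℝ) ^ (ω * t) + 1) + 1) *
          ((2 / c) ^ s * (2 : ℝ) ^ (-(v + β) * s * t)))
        ≤ 25 * (2 : ℝ) ^ (2 * (t : ℝ)) * (((2 * V + 3) * (2 : ℝ) ^ (ω * t)) *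
          ((2 / c) ^ s * (2 : ℝ) ^ (-(v + β) * s * t))) := by
          gcongr; linarith
      _ = 25 * ((2 * V + 3) * (2 / c) ^ s) * ((2 : ℝ) ^ (2 * (t : ℝ)) * (2 : ℝ) ^ (ω * t) *
          (2 : ℝ) ^ (-(v + β) * s * t)) := by ring
      _ = _ := by
          rw [← Real.rpow_add h2, ← Real.rpow_add h2]
          congr 2; ring

/-- A short arc `(f₁, f₂)` with a shift `l`, together with first derivatives `d₁, d₂, dl` and second
derivatives `e₁, e₂, el`, on which every linear combination of `f₁, f₂` has either a uniformly large
first derivative or a uniformly large second derivative. -/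
structure Arc where
  (f₁ f₂ l d₁ d₂ dl e₁ e₂ el : ℝ → ℝ)
  (u w c C : ℝ)
  huw : u ≤ w
  hlen : w - u ≤ 1
  hc : 0 < c
  hc1 : c ≤ 1
  hC : 1 ≤ C
  hf₁ : ∀ x ∈ Icc u w, HasDerivAt f₁ (d₁ x) x
  hf₂ : ∀ x ∈ Icc u w, HasDerivAt f₂ (d₂ x) x
  hl : ∀ x ∈ Icc u w, HasDerivAt l (dl x) x
  hd₁ : ∀ x ∈ Icc u w, HasDerivAt d₁ (e₁ x) x
  hd₂ : ∀ x ∈ Icc u w, HasDerivAt d₂ (e₂ x) x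
  hdl : ∀ x ∈ Icc u w, HasDerivAt dl (el x) x
  bd₁ : ∀ x ∈ Icc u w, |d₁ x| ≤ C
  bd₂ : ∀ x ∈ Icc u w, |d₂ x| ≤ C
  bdl : ∀ x ∈ Icc u w, |dl x| ≤ C
  be₁ : ∀ x ∈ Icc u w, |e₁ x| ≤ C
  be₂ : ∀ x ∈ Icc u w, |e₂ x| ≤ C
  bel : ∀ x ∈ Icc u w, |el x| ≤ C
  nondeg : ∀ x ∈ Icc u w, c ≤ |d₁ x| ∨ c ≤ |d₂ x|
  dich : ∀ a₁ a₂ : ℝ,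
    (∀ x ∈ Icc u w, 2 * c * max |a₁| |a₂| ≤ a₁ * d₁ x + a₂ * d₂ x) ∨
    (∀ x ∈ Icc u w, 2 * c * max |a₁| |a₂| ≤ -(a₁ * d₁ x + a₂ * d₂ x)) ∨
    (∀ x ∈ Icc u w, 2 * c * max |a₁| |a₂| ≤ a₁ * e₁ x + a₂ * e₂ x) ∨
    (∀ x ∈ Icc u w, 2 * c * max |a₁| |a₂| ≤ -(a₁ * e₁ x + a₂ * e₂ x))

namespace Arc

variable (A : Arc)

/-- The parameter interval of the arc. -/
def J : Set ℝ := Icc A.u A.w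

/-- The linear form `a₁ f₁ + a₂ f₂ + l`. -/
def F (a : ℤ × ℤ) (x : ℝ) : ℝ := a.1 * A.f₁ x + a.2 * A.f₂ x + A.l x

/-- The first derivative of `A.F a`. -/
def G (a : ℤ × ℤ) (x : ℝ) : ℝ := a.1 * A.d₁ x + a.2 * A.d₂ x + A.dl x

/-- The second derivative of `A.F a`. -/
def K (a : ℤ × ℤ) (x : ℝ) : ℝ := a.1 * A.e₁ x + a.2 * A.e₂ x + A.el x

lemma ordConnected_J : A.J.OrdConnected := ordConnected_Icc

lemma hasDerivAt_F (a : ℤ × ℤ) {x : ℝ} (hx : x ∈ A.J) : HasDerivAt (A.F a) (A.G a x) x :=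
  (((A.hf₁ x hx).const_mul (a.1 : ℝ)).add ((A.hf₂ x hx).const_mul (a.2 : ℝ))).add (A.hl x hx)

lemma hasDerivAt_G (a : ℤ × ℤ) {x : ℝ} (hx : x ∈ A.J) : HasDerivAt (A.G a) (A.K a x) x :=
  (((A.hd₁ x hx).const_mul (a.1 : ℝ)).add ((A.hd₂ x hx).const_mul (a.2 : ℝ))).add (A.hdl x hx)

lemma abs_comb_le {a : ℤ × ℤ} {t : ℕ} (ha : Shell t a) {y₁ y₂ y₃ : ℝ} (h₁ : |y₁| ≤ A.C)
    (h₂ : |y₂| ≤ A.C) (h₃ : |y₃| ≤ A.C) : |a.1 * y₁ + a.2 * y₂ + y₃| ≤ 5 * A.C * 2 ^ t := by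
  have hC := A.hC
  have ht : (1 : ℝ) ≤ 2 ^ t := one_le_pow₀ (by norm_num)
  calc |a.1 * y₁ + a.2 * y₂ + y₃| ≤ |a.1 * y₁| + |a.2 * y₂| + |y₃| := abs_add_three _ _ _
    _ = |(a.1 : ℝ)| * |y₁| + |(a.2 : ℝ)| * |y₂| + |y₃| := by rw [abs_mul, abs_mul]
    _ ≤ (2 * 2 ^ t) * A.C + (2 * 2 ^ t) * A.C + A.C := by
        gcongr
        · exact ha.abs_fst_le
        · exact ha.abs_snd_le
    _ ≤ _ := by nlinarith

lemma abs_G_le {a : ℤ × ℤ} {t : ℕ} (ha : Shell t a) {x : ℝ} (hx : x ∈ A.J) :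
    |A.G a x| ≤ 5 * A.C * 2 ^ t :=
  A.abs_comb_le ha (A.bd₁ x hx) (A.bd₂ x hx) (A.bdl x hx)

lemma abs_K_le {a : ℤ × ℤ} {t : ℕ} (ha : Shell t a) {x : ℝ} (hx : x ∈ A.J) :
    |A.K a x| ≤ 5 * A.C * 2 ^ t :=
  A.abs_comb_le ha (A.be₁ x hx) (A.be₂ x hx) (A.bel x hx)

/-- The first derivative of `A.F a` is large on the whole arc. -/
def Steep (t : ℕ) (a : ℤ × ℤ) : Prop := ∀ x ∈ A.J, A.c * 2 ^ t ≤ A.G a x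

/-- The second derivative of `A.F a` is large on the whole arc. -/
def Curved (t : ℕ) (a : ℤ × ℤ) : Prop := ∀ x ∈ A.J, A.c * 2 ^ t ≤ A.K a x

/-- The same arc with the opposite shift. -/
def neg : Arc where
  __ := A
  l := fun x => -A.l x
  dl := fun x => -A.dl x
  el := fun x => -A.el x
  hl := fun x hx => (A.hl x hx).neg
  hdl := fun x hx => (A.hdl x hx).neg
  bdl := fun x hx => by simpa using A.bdl x hx
  bel := fun x hx => by simpa using A.bel x hx

lemma F_neg (a : ℤ × ℤ) (x : ℝ) : A.neg.F (-a) x = -A.F a x := by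
  simp only [F, neg, Prod.fst_neg, Prod.snd_neg]; push_cast; ring

lemma G_neg (a : ℤ × ℤ) (x : ℝ) : A.neg.G (-a) x = -A.G a x := by
  simp only [G, neg, Prod.fst_neg, Prod.snd_neg]; push_cast; ring

lemma K_neg (a : ℤ × ℤ) (x : ℝ) : A.neg.K (-a) x = -A.K a x := by
  simp only [K, neg, Prod.fst_neg, Prod.snd_neg]; push_cast; ring

lemma steep_or_curved {t : ℕ} (ht : A.C ≤ A.c * 2 ^ t) {a : ℤ × ℤ} (ha : Shell t a) :
    (A.Steep t a ∨ A.Curved t a) ∨ (A.neg.Steep t (-a) ∨ A.neg.Curved t (-a)) := by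
  have hm := ha.le_max
  have hc := A.hc
  have hm' : A.c * 2 ^ t ≤ A.c * max |(a.1 : ℝ)| |(a.2 : ℝ)| := by gcongr
  rcases A.dich a.1 a.2 with h | h | h | h
  · refine Or.inl (Or.inl fun x hx => ?_)
    have := abs_le.1 (A.bdl x hx)
    have := h x hx
    simp only [G]; linarith
  · refine Or.inr (Or.inl fun x hx => ?_)
    have := abs_le.1 (A.bdl x hx)
    have := h x hx
    rw [G_neg]
    simp only [neg, G]; linarith
  · refine Or.inl (Or.inr fun x hx => ?_)
    have := abs_le.1 (A.bel x hx)
    have := h x hx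
    simp only [K]; linarith
  · refine Or.inr (Or.inr fun x hx => ?_)
    have := abs_le.1 (A.bel x hx)
    have := h x hx
    rw [K_neg]
    simp only [neg, K]; linarith

lemma dist_le_of_abs_hom_le (d : ℤ × ℤ) {D : ℝ} (hD : 0 < D)
    (hDd : D ≤ max |(d.1 : ℝ)| |(d.2 : ℝ)|) {r x x' : ℝ} (hx : x ∈ A.J) (hx' : x' ∈ A.J)
    (h : |d.1 * A.d₁ x + d.2 * A.d₂ x| ≤ r) (h' : |d.1 * A.d₁ x' + d.2 * A.d₂ x'| ≤ r) :
    |x - x'| ≤ r / (A.c * D) := by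
  have hc := A.hc
  have hr : 0 ≤ r := (abs_nonneg _).trans h
  have hcm : A.c * D ≤ A.c * max |(d.1 : ℝ)| |(d.2 : ℝ)| := by gcongr
  have hlen : |x - x'| ≤ 1 := by
    have h1 := hx.1
    have h2 := hx.2
    have h3 := hx'.1
    have h4 := hx'.2
    have := A.hlen
    rw [abs_le]; constructor <;> linarith
  have hcD : 0 < A.c * D := by positivity
  have hderiv : ∀ z ∈ A.J, HasDerivAt (fun z => d.1 * A.d₁ z + d.2 * A.d₂ z)
      (d.1 * A.e₁ z + d.2 * A.e₂ z) z := fun z hz =>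
    ((A.hd₁ z hz).const_mul (d.1 : ℝ)).add ((A.hd₂ z hz).const_mul (d.2 : ℝ))
  rw [le_div_iff₀ hcD]
  have h2 := abs_le.1 h
  have h2' := abs_le.1 h'
  rcases A.dich d.1 d.2 with H | H | H | H
  · have := H x hx
    nlinarith
  · have := H x hx
    nlinarith
  · have := mul_abs_sub_le_of_le_deriv A.ordConnected_J hderiv H hx hx'
    have h3 : |d.1 * A.d₁ x + d.2 * A.d₂ x - (d.1 * A.d₁ x' + d.2 * A.d₂ x')| ≤ 2 * r := by
      rw [abs_le]; constructor <;> linarith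
    nlinarith [abs_nonneg (x - x')]
  · have := mul_abs_sub_le_of_le_deriv A.ordConnected_J (fun z hz => (hderiv z hz).neg) H hx hx'
    simp only [Pi.neg_apply] at this
    have h3 : |-(d.1 * A.d₁ x + d.2 * A.d₂ x) - -(d.1 * A.d₁ x' + d.2 * A.d₂ x')| ≤ 2 * r := by
      rw [abs_le]; constructor <;> linarith
    nlinarith [abs_nonneg (x - x')]

lemma abs_F_sub_le {a : ℤ × ℤ} {t : ℕ} (ha : Shell t a) {x y η r : ℝ} (hx : x ∈ A.J)
    (hy : y ∈ A.J) (hη : |A.G a x| ≤ η) (hr : |x - y| ≤ r) :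
    |A.F a y - A.F a x| ≤ (η + 5 * A.C * 2 ^ t * r) * r := by
  have hC := A.hC
  have hsub : uIcc x y ⊆ A.J := A.ordConnected_J.uIcc_subset hx hy
  have hη0 : 0 ≤ η := (abs_nonneg _).trans hη
  have hr0 : 0 ≤ r := (abs_nonneg _).trans hr
  have hbd : ∀ z ∈ uIcc x y, |A.G a z| ≤ η + 5 * A.C * 2 ^ t * r := by
    intro z hz
    have h1 := abs_sub_le_of_abs_deriv_le A.ordConnected_J (fun z hz => A.hasDerivAt_G a hz)
      (fun z hz => A.abs_K_le ha hz) (hsub hz) hx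
    have h2 : |z - x| ≤ r := (abs_sub_left_of_mem_uIcc hz).trans (by rwa [abs_sub_comm])
    have h3 : |A.G a z| ≤ |A.G a z - A.G a x| + |A.G a x| := by
      simpa using abs_add_le (A.G a z - A.G a x) (A.G a x)
    have h4 : 5 * A.C * 2 ^ t * |z - x| ≤ 5 * A.C * 2 ^ t * r := by gcongr
    linarith
  refine (abs_sub_le_of_abs_deriv_le ordConnected_uIcc
    (fun z hz => A.hasDerivAt_F a (hsub hz)) hbd right_mem_uIcc left_mem_uIcc).trans ?_
  gcongr
  rwa [abs_sub_comm]

end Arc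

lemma quadratic_bound {κ δ η α₁ α₃ y z ζ A₁ A₃ : ℝ} (hκ : 0 < κ) (hη : 0 < η) (hz : 0 ≤ z)
    (hα : α₁ + α₃ = 1) (hα₁ : 1 / 2 ≤ α₁) (hα₃ : 0 ≤ α₃)
    (hy : α₁ * A₁ + α₃ * A₃ = y) (hyδ : y ≤ δ) (q₁ : -δ - η * z + κ / 2 * z ^ 2 ≤ A₁)
    (q₃ : -δ - η * ζ + κ / 2 * ζ ^ 2 ≤ A₃) (hδκ : δ * κ ≤ η ^ 2) : z ≤ 12 * η / κ := by
  have q₁' : -(δ * κ) - η * (κ * z) + (κ * z) ^ 2 / 2 ≤ κ * A₁ := by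
    have := mul_le_mul_of_nonneg_left q₁ hκ.le
    linarith
  have q₃' : -(δ * κ) - η ^ 2 / 2 ≤ κ * A₃ := by
    have := mul_le_mul_of_nonneg_left q₃ hκ.le
    linarith [sq_nonneg (κ * ζ - η)]
  have hsum : κ * y = α₁ * (κ * A₁) + α₃ * (κ * A₃) := by rw [← hy]; ring
  have hy' : κ * y ≤ δ * κ := by rw [mul_comm δ]; gcongr
  rw [le_div_iff₀ hκ, mul_comm z]
  have hw0 : 0 ≤ κ * z := by positivity
  generalize κ * z = w at *
  by_contra hcon
  rw [not_le] at hcon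
  have m₁ := mul_le_mul_of_nonneg_left q₁' (by linarith : 0 ≤ α₁)
  have m₃ := mul_le_mul_of_nonneg_left q₃' hα₃
  have pos : 0 ≤ w * (w / 2 - η) := mul_nonneg hw0 (by linarith)
  have m₁' : (1 / 2) * (w * (w / 2 - η)) ≤ α₁ * (w * (w / 2 - η)) := by gcongr
  have m₃' : α₃ * (η ^ 2 / 2) ≤ 1 * (η ^ 2 / 2) := by gcongr; linarith
  have e : α₁ * (δ * κ) + α₃ * (δ * κ) = δ * κ := by rw [← add_mul, hα, one_mul]
  have h1 : (1 / 2) * (w * (w / 2 - η)) ≤ 3 * η ^ 2 := by linarith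
  have h2 : (12 * η) * (5 * η) ≤ w * (w / 2 - η) := by gcongr; linarith
  nlinarith

/-- If a convex combination of two uniformly convex functions is small at `x₂` while both functions
are small with small derivative at `x₁`, `x₃`, then `x₂` is close to the point carrying the larger
weight. -/
lemma close_of_convex_comb {F₁ G₁ K₁ F₃ G₃ K₃ : ℝ → ℝ} {T : Set ℝ} (hT : T.OrdConnected)
    (hF₁ : ∀ x ∈ T, HasDerivAt F₁ (G₁ x) x) (hG₁ : ∀ x ∈ T, HasDerivAt G₁ (K₁ x) x)
    (hF₃ : ∀ x ∈ T, HasDerivAt F₃ (G₃ x) x) (hG₃ : ∀ x ∈ T, HasDerivAt G₃ (K₃ x) x)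
    {κ δ η α₁ α₃ y x₁ x₂ x₃ : ℝ} (hκ : 0 < κ) (hη : 0 < η)
    (hK₁ : ∀ x ∈ T, κ ≤ K₁ x) (hK₃ : ∀ x ∈ T, κ ≤ K₃ x)
    (hx₁ : x₁ ∈ T) (hx₂ : x₂ ∈ T) (hx₃ : x₃ ∈ T) (hα : α₁ + α₃ = 1) (hα₁ : 1 / 2 ≤ α₁)
    (hα₃ : 0 ≤ α₃) (hy : α₁ * F₁ x₂ + α₃ * F₃ x₂ = y) (hyδ : |y| ≤ δ)
    (h₁ : |F₁ x₁| ≤ δ) (h₃ : |F₃ x₃| ≤ δ) (g₁ : |G₁ x₁| ≤ η) (g₃ : |G₃ x₃| ≤ η)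
    (hδκ : δ * κ ≤ η ^ 2) : |x₂ - x₁| ≤ 12 * η / κ := by
  have hδ : 0 ≤ δ := (abs_nonneg _).trans hyδ
  have t₁ := taylor_lower hT hF₁ hG₁ hK₁ hx₂ hx₁
  have t₃ := taylor_lower hT hF₃ hG₃ hK₃ hx₂ hx₃
  set z := |x₂ - x₁| with hz
  have hz0 : 0 ≤ z := abs_nonneg _
  have p₁ : -(η * z) ≤ G₁ x₁ * (x₂ - x₁) := by
    have : |G₁ x₁ * (x₂ - x₁)| ≤ η * z := by rw [abs_mul]; gcongr
    exact (abs_le.1 this).1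
  have p₃ : -(η * |x₂ - x₃|) ≤ G₃ x₃ * (x₂ - x₃) := by
    have : |G₃ x₃ * (x₂ - x₃)| ≤ η * |x₂ - x₃| := by rw [abs_mul]; gcongr
    exact (abs_le.1 this).1
  have q₁ : -δ - η * z + κ / 2 * z ^ 2 ≤ F₁ x₂ := by
    rw [hz, sq_abs]; linarith [(abs_le.1 h₁).1]
  have q₃ : -δ - η * |x₂ - x₃| + κ / 2 * |x₂ - x₃| ^ 2 ≤ F₃ x₂ := by
    rw [sq_abs]; linarith [(abs_le.1 h₃).1]
  clear_value z
  generalize |x₂ - x₃| = ζ at q₃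
  generalize F₁ x₂ = A₁ at *
  generalize F₃ x₂ = A₃ at *
  exact quadratic_bound hκ hη hz0 hα hα₁ hα₃ hy (abs_le.1 hyδ).2 q₁ q₃ hδκ

namespace Arc

variable (A : Arc)

lemma abs_hom_le_of_dist {t : ℕ} {a b d : ℤ × ℤ} {j : ℤ} (hj : j ≠ 0)
    (h₁ : b.1 - a.1 = j * d.1) (h₂ : b.2 - a.2 = j * d.2) (ha : Shell t a) {x y η : ℝ}
    (hx : x ∈ A.J) (hy : y ∈ A.J) (gx : |A.G a x| ≤ η) (gy : |A.G b y| ≤ η)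
    (hxy : |y - x| ≤ 12 * η / (A.c * 2 ^ t)) :
    |d.1 * A.d₁ y + d.2 * A.d₂ y| ≤ (2 + 60 * A.C / A.c) * η := by
  have hc := A.hc
  have hC := A.hC
  have h1 : |A.G a y - A.G a x| ≤ 5 * A.C * 2 ^ t * |y - x| :=
    abs_sub_le_of_abs_deriv_le A.ordConnected_J (fun z hz => A.hasDerivAt_G a hz)
      (fun z hz => A.abs_K_le ha hz) hy hx
  have h2 : 5 * A.C * 2 ^ t * |y - x| ≤ 60 * A.C / A.c * η := by
    calc _ ≤ 5 * A.C * 2 ^ t * (12 * η / (A.c * 2 ^ t)) := by gcongr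
      _ = _ := by field_simp; ring
  have h3 : (j : ℝ) * (d.1 * A.d₁ y + d.2 * A.d₂ y) = A.G b y - A.G a y := by
    have e1 : (b.1 : ℝ) - a.1 = j * d.1 := by exact_mod_cast h₁
    have e2 : (b.2 : ℝ) - a.2 = j * d.2 := by exact_mod_cast h₂
    simp only [G]
    linear_combination (-A.d₁ y) * e1 - (A.d₂ y) * e2
  have h4 : (1 : ℝ) ≤ |(j : ℝ)| := by exact_mod_cast Int.one_le_abs hj
  have h5 : |A.G b y - A.G a y| ≤ (2 + 60 * A.C / A.c) * η := by
    have := abs_le.1 gx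
    have := abs_le.1 gy
    have := abs_le.1 h1
    rw [abs_le]
    constructor <;> linarith
  rw [← h3, abs_mul] at h5
  exact (le_mul_of_one_le_left (abs_nonneg _) h4).trans h5

lemma convex_comb_eq {t : ℕ} {a₁ a₂ a₃ d : ℤ × ℤ} {j k : ℤ} (hj : 0 < j) (hk : 0 < k)
    (hd : d ≠ 0) (e₁ : a₂.1 - a₁.1 = j * d.1) (e₁' : a₂.2 - a₁.2 = j * d.2)
    (e₃ : a₃.1 - a₂.1 = k * d.1) (e₃' : a₃.2 - a₂.2 = k * d.2)
    (s₁ : Shell t a₁) (s₃ : Shell t a₃) {z ζ : ℝ} {p₁ p₂ p₃ : ℤ} (h₁ : |A.F a₁ z - p₁| ≤ ζ)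
    (h₂ : |A.F a₂ z - p₂| ≤ ζ) (h₃ : |A.F a₃ z - p₃| ≤ ζ) (hζ : 8 * 2 ^ t * ζ < 1) (x : ℝ) :
    (j + k) * (A.F a₂ x - p₂) = k * (A.F a₁ x - p₁) + j * (A.F a₃ x - p₃) := by
  have hj' : (0 : ℝ) < j := by exact_mod_cast hj
  have hk' : (0 : ℝ) < k := by exact_mod_cast hk
  have r₁ : (a₂.1 : ℝ) - a₁.1 = j * d.1 := by exact_mod_cast e₁
  have r₁' : (a₂.2 : ℝ) - a₁.2 = j * d.2 := by exact_mod_cast e₁'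
  have r₃ : (a₃.1 : ℝ) - a₂.1 = k * d.1 := by exact_mod_cast e₃
  have r₃' : (a₃.2 : ℝ) - a₂.2 = k * d.2 := by exact_mod_cast e₃'
  have key : ∀ x, (j + k) * A.F a₂ x = k * A.F a₁ x + j * A.F a₃ x := by
    intro x
    simp only [F]
    linear_combination (k * A.f₁ x) * r₁ + (k * A.f₂ x) * r₁' - (j * A.f₁ x) * r₃ -
      (j * A.f₂ x) * r₃'
  have hζ0 : 0 ≤ ζ := (abs_nonneg _).trans h₁
  have hjk : (j + k : ℝ) ≤ 4 * 2 ^ t := by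
    have aux : ∀ y y' e : ℝ, |y| ≤ 2 * 2 ^ t → |y'| ≤ 2 * 2 ^ t → 1 ≤ |e| →
        y' - y = (j + k) * e → (j + k : ℝ) ≤ 4 * 2 ^ t := by
      intro y y' e hy hy' he h
      have h1 : |y' - y| ≤ 4 * 2 ^ t := (abs_sub _ _).trans (by linarith)
      rw [h, abs_mul, abs_of_pos (by linarith)] at h1
      exact (le_mul_of_one_le_right (by linarith) he).trans h1
    by_cases h0 : d.1 = 0
    · have h0' : d.2 ≠ 0 := fun h => hd (Prod.ext h0 h)
      exact aux _ _ (d.2 : ℝ) s₁.abs_snd_le s₃.abs_snd_le (by exact_mod_cast Int.one_le_abs h0')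
        (by linarith)
    · exact aux _ _ (d.1 : ℝ) s₁.abs_fst_le s₃.abs_fst_le (by exact_mod_cast Int.one_le_abs h0)
        (by linarith)
  have hp : (j + k) * p₂ = k * p₁ + j * p₃ := by
    rw [← sub_eq_zero, ← Int.abs_lt_one_iff]
    have : |(j + k) * (p₂ : ℝ) - (k * p₁ + j * p₃)| < 1 := by
      have e : (j + k) * (p₂ : ℝ) - (k * p₁ + j * p₃) =
          k * (A.F a₁ z - p₁) + j * (A.F a₃ z - p₃) - (j + k) * (A.F a₂ z - p₂) := by
        linear_combination key z
      have hh : (j + k) * ζ ≤ 4 * 2 ^ t * ζ := by gcongr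
      have b₁ : |(k : ℝ) * (A.F a₁ z - p₁)| ≤ k * ζ := by
        rw [abs_mul, abs_of_pos hk']; gcongr
      have b₃ : |(j : ℝ) * (A.F a₃ z - p₃)| ≤ j * ζ := by
        rw [abs_mul, abs_of_pos hj']; gcongr
      have b₂ : |(j + k : ℝ) * (A.F a₂ z - p₂)| ≤ (j + k) * ζ := by
        rw [abs_mul, abs_of_pos (by linarith)]; gcongr
      rw [e]
      have := abs_le.1 b₁
      have := abs_le.1 b₂
      have := abs_le.1 b₃
      rw [abs_lt]; constructor <;> linarith
    exact_mod_cast this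
  have hp' : (j + k) * (p₂ : ℝ) = k * p₁ + j * p₃ := by exact_mod_cast hp
  linear_combination key x - hp'

/-- If `a₂` lies strictly between `a₁` and `a₃` on a line with direction `d` and the three forms are
near integers with small slope in a common short interval, then the homogeneous form of `d` is
small. -/
lemma abs_hom_le_of_between {t : ℕ} {a₁ a₂ a₃ d : ℤ × ℤ} {j k : ℤ} (hj : 0 < j) (hk : 0 < k)
    (hd : d ≠ 0) (e₁ : a₂.1 - a₁.1 = j * d.1) (e₁' : a₂.2 - a₁.2 = j * d.2)
    (e₃ : a₃.1 - a₂.1 = k * d.1) (e₃' : a₃.2 - a₂.2 = k * d.2)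
    (s₁ : Shell t a₁) (s₂ : Shell t a₂) (s₃ : Shell t a₃) (c₁ : A.Curved t a₁)
    (c₃ : A.Curved t a₃) {z x₁ x₂ x₃ r δ η : ℝ} (hz : z ∈ A.J) (hx₁ : x₁ ∈ A.J) (hx₂ : x₂ ∈ A.J)
    (hx₃ : x₃ ∈ A.J) (r₁ : |x₁ - z| ≤ r) (r₂ : |x₂ - z| ≤ r) (r₃ : |x₃ - z| ≤ r)
    {p₁ p₂ p₃ : ℤ} (h₁ : |A.F a₁ x₁ - p₁| ≤ δ) (h₂ : |A.F a₂ x₂ - p₂| ≤ δ)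
    (h₃ : |A.F a₃ x₃ - p₃| ≤ δ) (g₁ : |A.G a₁ x₁| ≤ η) (g₂ : |A.G a₂ x₂| ≤ η)
    (g₃ : |A.G a₃ x₃| ≤ η) (hη : 0 < η) (hη1 : η ≤ 1) (hδη : δ * 2 ^ t ≤ η ^ 2)
    (hδ : δ * 2 ^ t ≤ 1 / 16) (hr : 100 * A.C * 2 ^ t * r ≤ 1) :
    |d.1 * A.d₁ x₂ + d.2 * A.d₂ x₂| ≤ (2 + 60 * A.C / A.c) * η := by
  have hc := A.hc
  have hC := A.hC
  have hr0 : 0 ≤ r := (abs_nonneg _).trans r₁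
  have hδ0 : 0 ≤ δ := (abs_nonneg _).trans h₁
  have hj' : (0 : ℝ) < j := by exact_mod_cast hj
  have hk' : (0 : ℝ) < k := by exact_mod_cast hk
  have ht : (0 : ℝ) < 2 ^ t := by positivity
  have near : ∀ {a : ℤ × ℤ} {x : ℝ} {p : ℤ}, Shell t a → x ∈ A.J → |x - z| ≤ r →
      |A.F a x - p| ≤ δ → |A.G a x| ≤ η →
      |A.F a z - p| ≤ δ + (η + 5 * A.C * 2 ^ t * r) * r := by
    intro a x p hs hx hxr hp hg
    have h1 := abs_le.1 (A.abs_F_sub_le hs hx hz hg hxr)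
    have h2 := abs_le.1 hp
    rw [abs_le]; constructor <;> linarith
  have hζ : 8 * 2 ^ t * (δ + (η + 5 * A.C * 2 ^ t * r) * r) < 1 := by
    have h1 : η + 5 * A.C * 2 ^ t * r ≤ 2 := by linarith
    have h2 : (η + 5 * A.C * 2 ^ t * r) * r ≤ 2 * r := by gcongr
    have h3 : 2 ^ t * ((η + 5 * A.C * 2 ^ t * r) * r) ≤ 2 ^ t * (2 * r) := by gcongr
    have h4 : 1 * (2 ^ t * r) ≤ A.C * (2 ^ t * r) := by gcongr
    linarith
  have key := A.convex_comb_eq hj hk hd e₁ e₁' e₃ e₃' s₁ s₃ (near s₁ hx₁ r₁ h₁ g₁)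
    (near s₂ hx₂ r₂ h₂ g₂) (near s₃ hx₃ r₃ h₃ g₃) hζ x₂
  have hδκ : δ * (A.c * 2 ^ t) ≤ η ^ 2 := by
    have : A.c * (δ * 2 ^ t) ≤ 1 * (δ * 2 ^ t) := by gcongr; exact A.hc1
    linarith
  have D : ∀ (a : ℤ × ℤ) (p : ℤ), ∀ x ∈ A.J, HasDerivAt (fun y => A.F a y - p) (A.G a x) x :=
    fun a p x hx => (A.hasDerivAt_F a hx).sub_const _
  have hjk : (0 : ℝ) < j + k := by linarith
  rcases le_total j k with hle | hle
  · have hle' : (j : ℝ) ≤ k := by exact_mod_cast hle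
    refine A.abs_hom_le_of_dist hj.ne' e₁ e₁' s₁ hx₁ hx₂ g₁ g₂ ?_
    refine close_of_convex_comb (α₁ := k / (j + k)) (α₃ := j / (j + k)) A.ordConnected_J (D a₁ p₁)
      (fun x hx => A.hasDerivAt_G a₁ hx) (D a₃ p₃) (fun x hx => A.hasDerivAt_G a₃ hx)
      (by positivity) hη c₁ c₃ hx₁ hx₂ hx₃ ?_ ?_ (by positivity) ?_ h₂ h₁ h₃ g₁ g₃ hδκ
    · field_simp; ring
    · rw [le_div_iff₀ hjk]; linarith
    · field_simp; linarith
  · have hle' : (k : ℝ) ≤ j := by exact_mod_cast hle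
    refine A.abs_hom_le_of_dist (a := a₃) (j := -k) (neg_ne_zero.2 hk.ne') (by linarith)
      (by linarith) s₃ hx₃ hx₂ g₃ g₂ ?_
    refine close_of_convex_comb (α₁ := j / (j + k)) (α₃ := k / (j + k)) A.ordConnected_J (D a₃ p₃)
      (fun x hx => A.hasDerivAt_G a₃ hx) (D a₁ p₁) (fun x hx => A.hasDerivAt_G a₁ hx)
      (by positivity) hη c₃ c₁ hx₃ hx₂ hx₁ ?_ ?_ (by positivity) ?_ h₂ h₃ h₁ g₃ g₁ hδκ
    · field_simp
    · rw [le_div_iff₀ hjk]; linarith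
    · field_simp; linarith

end Arc

lemma exists_shell {d : ℤ × ℤ} (hd : d ≠ 0) : ∃ k, Shell k d := by
  have h : max d.1.natAbs d.2.natAbs ≠ 0 := by
    intro h
    have h1 : d.1.natAbs = 0 := Nat.eq_zero_of_le_zero (h ▸ le_max_left _ _)
    have h2 : d.2.natAbs = 0 := Nat.eq_zero_of_le_zero (h ▸ le_max_right _ _)
    exact hd (Prod.ext (Int.natAbs_eq_zero.1 h1) (Int.natAbs_eq_zero.1 h2))
  exact ⟨Nat.log 2 (max d.1.natAbs d.2.natAbs), Nat.pow_log_le_self 2 h,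
    Nat.lt_pow_succ_log_self (by norm_num) _⟩

lemma Shell.ne_zero {k : ℕ} {d : ℤ × ℤ} (h : Shell k d) : d ≠ 0 := by
  rintro rfl
  have := h.1
  simp at this

lemma exists_eq_mul_of_wedge_eq_zero {d e : ℤ × ℤ} (hd : IsCoprime d.1 d.2)
    (h : e.1 * d.2 = e.2 * d.1) : ∃ j : ℤ, e.1 = j * d.1 ∧ e.2 = j * d.2 := by
  obtain ⟨m, n, hmn⟩ := hd
  refine ⟨m * e.1 + n * e.2, ?_, ?_⟩
  · linear_combination (-e.1) * hmn + n * h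
  · linear_combination (-e.2) * hmn - m * h

namespace Arc

variable (A : Arc)

/-- The points of the arc at which some nonzero integer vector of norm below `2 ^ m` is nearly
orthogonal to the tangent. -/
def Rich (m : ℕ) (ρ : ℝ) : Set ℝ :=
  {x ∈ A.J | ∃ k < m, ∃ d, Shell k d ∧ |d.1 * A.d₁ x + d.2 * A.d₂ x| ≤ ρ}

lemma hcontent_rich_le {s : ℝ} {hs : 0 < s} (hs1 : s ≤ 1) (m : ℕ) {ρ : ℝ} (hρ : 0 ≤ ρ) :
    hcontent s hs (A.Rich m ρ) ≤
      ENNReal.ofReal (25 * (ρ / A.c) ^ s * ((2 : ℝ) ^ m) ^ (2 - s)) := by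
  classical
  have hc := A.hc
  refine (measure_mono (t := ⋃ k ∈ Finset.range m, ⋃ d ∈ (box k).filter (Shell k),
    {x ∈ A.J | |d.1 * A.d₁ x + d.2 * A.d₂ x| ≤ ρ}) ?_).trans
    ((measure_biUnion_finset_le _ _).trans ?_)
  · rintro x ⟨hx, k, hk, d, hd, h⟩
    simp only [mem_iUnion, Finset.mem_filter, Finset.mem_range, exists_prop]
    exact ⟨k, hk, d, ⟨hd.mem_box, hd⟩, hx, h⟩
  have step : ∀ k ∈ Finset.range m, hcontent s hs (⋃ d ∈ (box k).filter (Shell k),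
      {x ∈ A.J | |d.1 * A.d₁ x + d.2 * A.d₂ x| ≤ ρ}) ≤
      ENNReal.ofReal (25 * (ρ / A.c) ^ s * ((2 : ℝ) ^ m) ^ (1 - s) * 2 ^ k) := by
    intro k hk
    refine (hcontent_biUnion_le (N := 25 * ((2 : ℝ) ^ k) ^ 2) (B := (ρ / (A.c * 2 ^ k)) ^ s) _ _
      (by positivity) ?_ ?_).trans (ENNReal.ofReal_le_ofReal ?_)
    · refine le_trans ?_ (card_box_le k)
      exact_mod_cast Finset.card_filter_le _ _
    · intro d hd
      refine hcontent_le_of_dist hs (by positivity) fun x hx y hy => ?_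
      exact A.dist_le_of_abs_hom_le d (by positivity) (Finset.mem_filter.1 hd).2.le_max hx.1 hy.1
        hx.2 hy.2
    · have h2 : (0 : ℝ) < 2 ^ k := by positivity
      have e1 : (ρ / (A.c * 2 ^ k)) ^ s = (ρ / A.c) ^ s * ((2 : ℝ) ^ k) ^ (-s) := by
        rw [← div_div, Real.div_rpow (by positivity) h2.le, Real.rpow_neg h2.le, div_eq_mul_inv]
      have e2 : ((2 : ℝ) ^ k) ^ 2 * ((2 : ℝ) ^ k) ^ (-s) = ((2 : ℝ) ^ k) ^ (1 - s) * 2 ^ k := by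
        rw [sub_eq_add_neg, Real.rpow_add h2, Real.rpow_one]; ring
      have e3 : ((2 : ℝ) ^ k) ^ (1 - s) ≤ ((2 : ℝ) ^ m) ^ (1 - s) := by
        have : k ≤ m := (Finset.mem_range.1 hk).le
        gcongr
        · linarith
      rw [e1]
      calc 25 * ((2 : ℝ) ^ k) ^ 2 * ((ρ / A.c) ^ s * ((2 : ℝ) ^ k) ^ (-s))
          = 25 * (ρ / A.c) ^ s * (((2 : ℝ) ^ k) ^ 2 * ((2 : ℝ) ^ k) ^ (-s)) := by ring
        _ = 25 * (ρ / A.c) ^ s * ((2 : ℝ) ^ k) ^ (1 - s) * 2 ^ k := by rw [e2]; ring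
        _ ≤ _ := by gcongr
  refine (Finset.sum_le_sum step).trans ?_
  rw [← ENNReal.ofReal_sum_of_nonneg fun k _ => by positivity, ← Finset.mul_sum]
  refine ENNReal.ofReal_le_ofReal ?_
  have h2 : (0 : ℝ) < 2 ^ m := by positivity
  have e : ((2 : ℝ) ^ m) ^ (2 - s) = ((2 : ℝ) ^ m) ^ (1 - s) * 2 ^ m := by
    rw [show 2 - s = 1 - s + 1 by ring, Real.rpow_add h2, Real.rpow_one]
  have g : ∑ k ∈ Finset.range m, (2 : ℝ) ^ k ≤ 2 ^ m := by
    rw [geom_sum_eq (by norm_num)]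
    norm_num
  rw [e, ← mul_assoc]
  gcongr

lemma dirichlet_aux (q : ℕ) {y₁ y₂ C : ℝ} (hy : |y₂| ≤ |y₁|) (hC : |y₁| ≤ C) (h0 : y₁ ≠ 0) :
    ∃ j k : ℤ, k ≠ 0 ∧ |(j : ℝ)| ≤ 2 * 2 ^ q ∧ |(k : ℝ)| ≤ 2 * 2 ^ q ∧
      |j * y₁ + k * y₂| ≤ C / 2 ^ q := by
  obtain ⟨j, k, hk, hkn, h⟩ := Real.exists_int_int_abs_mul_sub_le (y₂ / y₁)
    (n := 2 ^ q) (by positivity)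
  have hq : (1 : ℝ) ≤ 2 ^ q := one_le_pow₀ (by norm_num)
  have hk' : (0 : ℝ) < k := by exact_mod_cast hk
  have hC0 : 0 ≤ C := (abs_nonneg _).trans hC
  have hkn' : (k : ℝ) ≤ 2 ^ q := by exact_mod_cast hkn
  have hξ : |y₂ / y₁| ≤ 1 := by
    rw [abs_div]; exact div_le_one_of_le₀ hy (abs_nonneg _)
  push_cast at h
  have h1 : |(k : ℝ) * (y₂ / y₁) - j| ≤ 1 / 2 ^ q :=
    h.trans (one_div_le_one_div_of_le (by positivity) (by linarith))
  refine ⟨-j, k, hk.ne', ?_, ?_, ?_⟩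
  · push_cast
    rw [abs_neg]
    have h2 : |(k : ℝ) * (y₂ / y₁)| ≤ 2 ^ q * 1 := by
      rw [abs_mul, abs_of_pos hk']; gcongr
    have h3 : (1 : ℝ) / 2 ^ q ≤ 1 := by
      rw [div_le_one (by positivity)]; exact hq
    have := abs_le.1 h1
    have := abs_le.1 h2
    rw [abs_le]; constructor <;> linarith
  · rw [abs_of_pos hk']; linarith
  · have : ((-j : ℤ) : ℝ) * y₁ + k * y₂ = y₁ * ((k : ℝ) * (y₂ / y₁) - j) := by
      push_cast; field_simp; ring
    rw [this, abs_mul]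
    calc |y₁| * |(k : ℝ) * (y₂ / y₁) - j| ≤ C * (1 / 2 ^ q) := by gcongr
      _ = _ := by ring

lemma exists_coprime_abs_hom_le (q : ℕ) {x : ℝ} (hx : x ∈ A.J) :
    ∃ d : ℤ × ℤ, IsCoprime d.1 d.2 ∧ (∃ k < q + 2, Shell k d) ∧ |(d.1 : ℝ)| ≤ 2 * 2 ^ q ∧
      |(d.2 : ℝ)| ≤ 2 * 2 ^ q ∧ |d.1 * A.d₁ x + d.2 * A.d₂ x| ≤ A.C / 2 ^ q := by
  have hc := A.hc
  obtain ⟨e, he0, he₁, he₂, he⟩ : ∃ e : ℤ × ℤ, e ≠ 0 ∧ |(e.1 : ℝ)| ≤ 2 * 2 ^ q ∧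
      |(e.2 : ℝ)| ≤ 2 * 2 ^ q ∧ |e.1 * A.d₁ x + e.2 * A.d₂ x| ≤ A.C / 2 ^ q := by
    have pos : 0 < |A.d₁ x| ∨ 0 < |A.d₂ x| :=
      (A.nondeg x hx).imp hc.trans_le hc.trans_le
    rcases le_total |A.d₂ x| |A.d₁ x| with h | h
    · obtain ⟨j, k, hk, h1, h2, h3⟩ := dirichlet_aux q h (A.bd₁ x hx)
        (abs_pos.1 (pos.elim id fun hp => hp.trans_le h))
      exact ⟨(j, k), fun h0 => hk (congrArg Prod.snd h0), h1, h2, h3⟩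
    · obtain ⟨j, k, hk, h1, h2, h3⟩ := dirichlet_aux q h (A.bd₂ x hx)
        (abs_pos.1 (pos.elim (fun hp => hp.trans_le h) id))
      exact ⟨(k, j), fun h0 => hk (congrArg Prod.fst h0), h2, h1, by rw [add_comm]; exact h3⟩
  have hg : Int.gcd e.1 e.2 ≠ 0 := by
    rw [Ne, Int.gcd_eq_zero_iff]
    exact fun h => he0 (Prod.ext h.1 h.2)
  obtain ⟨d₁, d₂, hcop, h₁, h₂⟩ := Int.exists_gcd_one (Nat.pos_of_ne_zero hg)
  set g := Int.gcd e.1 e.2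
  have hg1 : (1 : ℝ) ≤ |(g : ℝ)| := by
    rw [abs_of_nonneg (by positivity)]; exact_mod_cast Nat.pos_of_ne_zero hg
  have r₁ : (e.1 : ℝ) = d₁ * g := by rw [h₁]; push_cast; ring
  have r₂ : (e.2 : ℝ) = d₂ * g := by rw [h₂]; push_cast; ring
  have b₁ : |(d₁ : ℝ)| ≤ 2 * 2 ^ q := by
    rw [r₁, abs_mul] at he₁
    exact (le_mul_of_one_le_right (abs_nonneg _) hg1).trans he₁
  have b₂ : |(d₂ : ℝ)| ≤ 2 * 2 ^ q := by
    rw [r₂, abs_mul] at he₂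
    exact (le_mul_of_one_le_right (abs_nonneg _) hg1).trans he₂
  have hcop' : IsCoprime d₁ d₂ := Int.isCoprime_iff_gcd_eq_one.2 hcop
  have hd0 : ((d₁, d₂) : ℤ × ℤ) ≠ 0 := by
    intro h
    have h1 : d₁ = 0 := congrArg Prod.fst h
    have h2 : d₂ = 0 := congrArg Prod.snd h
    rw [h1, h2] at hcop
    simp at hcop
  obtain ⟨k, hk⟩ := exists_shell hd0
  refine ⟨(d₁, d₂), hcop', ⟨k, ?_, hk⟩, b₁, b₂, ?_⟩
  · have h1 : (2 : ℝ) ^ k ≤ 2 ^ (q + 1) := by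
      rw [pow_succ, mul_comm]; exact hk.le_max.trans (max_le b₁ b₂)
    have := (pow_le_pow_iff_right₀ (by norm_num : (1 : ℝ) < 2)).1 h1
    omega
  · rw [r₁, r₂, show (d₁ : ℝ) * g * A.d₁ x + d₂ * g * A.d₂ x =
      (d₁ * A.d₁ x + d₂ * A.d₂ x) * g by ring, abs_mul] at he
    exact (le_mul_of_one_le_right (abs_nonneg _) hg1).trans he

lemma abs_wedge_le {t q : ℕ} {a d : ℤ × ℤ} (ha : Shell t a) (hq : ((2 : ℝ) ^ q) ^ 2 ≤ 2 ^ t)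
    (hd₁ : |(d.1 : ℝ)| ≤ 2 * 2 ^ q) (hd₂ : |(d.2 : ℝ)| ≤ 2 * 2 ^ q) {x : ℝ} (hx : x ∈ A.J)
    (hd : |d.1 * A.d₁ x + d.2 * A.d₂ x| ≤ A.C / 2 ^ q) (hg : |A.G a x| ≤ 2) :
    |(a.1 * d.2 - a.2 * d.1 : ℝ)| ≤ 8 * A.C / A.c * (2 ^ t / 2 ^ q) := by
  have hc := A.hc
  have hC := A.hC
  have hl := A.bdl x hx
  have hh : |a.1 * A.d₁ x + a.2 * A.d₂ x| ≤ 3 * A.C := by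
    have e : a.1 * A.d₁ x + a.2 * A.d₂ x = A.G a x - A.dl x := by simp only [G]; ring
    rw [e]
    exact (abs_sub _ _).trans (by linarith)
  have hQ : (2 : ℝ) ^ q ≤ 2 ^ t / 2 ^ q := by
    rw [le_div_iff₀ (by positivity)]; nlinarith
  have fin : ∀ y₁ y₂ : ℝ, |y₁| ≤ 2 * 2 ^ q → |y₂| ≤ 2 * 2 ^ t →
      |y₁ * (a.1 * A.d₁ x + a.2 * A.d₂ x) - y₂ * (d.1 * A.d₁ x + d.2 * A.d₂ x)| ≤
        8 * A.C * (2 ^ t / 2 ^ q) := by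
    intro y₁ y₂ h₁ h₂
    calc _ ≤ |y₁ * (a.1 * A.d₁ x + a.2 * A.d₂ x)| + |y₂ * (d.1 * A.d₁ x + d.2 * A.d₂ x)| :=
          abs_sub _ _
      _ ≤ (2 * 2 ^ q) * (3 * A.C) + (2 * 2 ^ t) * (A.C / 2 ^ q) := by
          rw [abs_mul, abs_mul]; gcongr
      _ ≤ (2 * (2 ^ t / 2 ^ q)) * (3 * A.C) + (2 * 2 ^ t) * (A.C / 2 ^ q) := by gcongr
      _ = _ := by ring
  have hw : ∀ y : ℝ, A.c ≤ |y| → |(a.1 * d.2 - a.2 * d.1 : ℝ) * y| ≤ 8 * A.C * (2 ^ t / 2 ^ q) →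
      |(a.1 * d.2 - a.2 * d.1 : ℝ)| ≤ 8 * A.C / A.c * (2 ^ t / 2 ^ q) := by
    intro y hy h
    rw [div_mul_eq_mul_div, le_div_iff₀ hc]
    rw [abs_mul] at h
    exact (mul_le_mul_of_nonneg_left hy (abs_nonneg _)).trans h
  rcases A.nondeg x hx with h | h
  · refine hw _ h ?_
    convert fin d.2 a.2 hd₂ ha.abs_snd_le using 2
    ring
  · refine hw _ h ?_
    rw [← abs_neg]
    convert fin d.1 a.1 hd₁ ha.abs_fst_le using 2
    ring

end Arc

namespace Arc

variable (A : Arc)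

/-- Data at a single scale: `S a p` consists of points at which the curved form `a` is `δ`-close to
`p` with slope at most `η`. -/
structure Scale (t : ℕ) (δ η : ℝ) (S : ℤ × ℤ → ℤ → Set ℝ) : Prop where
  hη : 0 < η
  hη1 : η ≤ 1
  hδη : δ * 2 ^ t ≤ η ^ 2
  hδ : δ * 2 ^ t ≤ 1 / 16
  mem_J : ∀ {a p x}, x ∈ S a p → x ∈ A.J
  shell : ∀ {a p x}, x ∈ S a p → Shell t a
  curved : ∀ {a p x}, x ∈ S a p → A.Curved t a
  close : ∀ {a p x}, x ∈ S a p → |A.F a x - p| ≤ δ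
  slope : ∀ {a p x}, x ∈ S a p → |A.G a x| ≤ η

variable {A} {t : ℕ} {δ η : ℝ} {S : ℤ × ℤ → ℤ → Set ℝ}

lemma Scale.round_eq (h : A.Scale t δ η S) {a : ℤ × ℤ} {p : ℤ} {x z r : ℝ} (hx : x ∈ S a p)
    (hz : z ∈ A.J) (hr : 100 * A.C * 2 ^ t * r ≤ 1) (hxz : |x - z| ≤ r) :
    round (A.F a z) = p := by
  have hC := A.hC
  have hr0 : 0 ≤ r := (abs_nonneg _).trans hxz
  have h1 := abs_le.1 (A.abs_F_sub_le (h.shell hx) (h.mem_J hx) hz (h.slope hx) hxz)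
  have h2 := abs_le.1 (h.close hx)
  have ht : (1 : ℝ) ≤ 2 ^ t := one_le_pow₀ (by norm_num)
  have hδ0 : 0 ≤ δ := (abs_nonneg _).trans (h.close hx)
  have h3 : δ * 1 ≤ δ * 2 ^ t := by gcongr
  have h4 := h.hδ
  have h5 : η + 5 * A.C * 2 ^ t * r ≤ 2 := by linarith [h.hη1]
  have h6 : (η + 5 * A.C * 2 ^ t * r) * r ≤ 2 * r := by gcongr
  have h7 : (1 * 1) * r ≤ (A.C * 2 ^ t) * r := by gcongr
  rw [_root_.round_eq, Int.floor_eq_iff]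
  constructor <;> linarith

lemma Scale.abs_G_le_two (h : A.Scale t δ η S) {a : ℤ × ℤ} {p : ℤ} {x z r : ℝ} (hx : x ∈ S a p)
    (hz : z ∈ A.J) (hr : 100 * A.C * 2 ^ t * r ≤ 1) (hxz : |x - z| ≤ r) : |A.G a z| ≤ 2 := by
  have hC := A.hC
  have h1 : |A.G a z - A.G a x| ≤ 5 * A.C * 2 ^ t * |z - x| :=
    abs_sub_le_of_abs_deriv_le A.ordConnected_J (fun z hz => A.hasDerivAt_G a hz)
      (fun z hz => A.abs_K_le (h.shell hx) hz) hz (h.mem_J hx)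
  have h2 : 5 * A.C * 2 ^ t * |z - x| ≤ 5 * A.C * 2 ^ t * r := by
    rw [abs_sub_comm]; gcongr
  have h3 := abs_le.1 (h.slope hx)
  have h4 := abs_le.1 h1
  have h5 := h.hη1
  rw [abs_le]; constructor <;> linarith

lemma Scale.hcontent_line_le {s : ℝ} {hs : 0 < s} (h : A.Scale t δ η S) {B : ℝ} (hB0 : 0 ≤ B)
    (hB : ∀ a p, hcontent s hs (S a p) ≤ ENNReal.ofReal B) {z r : ℝ} (hz : z ∈ A.J)
    (hr : 100 * A.C * 2 ^ t * r ≤ 1) {d : ℤ × ℤ} (hd : IsCoprime d.1 d.2) {m : ℕ}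
    (hdm : ∃ k < m, Shell k d) (ℓ : ℤ) :
    hcontent s hs ({x | ∃ a p, x ∈ S a p ∧ |x - z| ≤ r ∧ a.1 * d.2 - a.2 * d.1 = ℓ} \
      A.Rich m ((2 + 60 * A.C / A.c) * η)) ≤ ENNReal.ofReal (2 * B) := by
  set P : Set (ℤ × ℤ) := {a | ∃ p x, x ∈ S a p ∧ |x - z| ≤ r ∧ a.1 * d.2 - a.2 * d.1 = ℓ} with hP
  have hfin : P.Finite := (Finset.finite_toSet (box t)).subset fun a ⟨p, x, hx, _⟩ =>
    (h.shell hx).mem_box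
  rcases P.eq_empty_or_nonempty with hemp | hne
  · refine (measure_mono (t := ∅) ?_).trans (by simp)
    rintro x ⟨⟨a, p, hx, hxz, hℓ⟩, -⟩
    exact hemp.subset (show a ∈ P from ⟨p, x, hx, hxz, hℓ⟩)
  obtain ⟨k, hkm, hk⟩ := hdm
  have hd0 := hk.ne_zero
  have hnorm : 0 < d.1 * d.1 + d.2 * d.2 := by
    rcases eq_or_ne d.1 0 with h1 | h1
    · have h2 : d.2 ≠ 0 := fun h2 => hd0 (Prod.ext h1 h2)
      have := mul_self_pos.2 h2
      nlinarith [mul_self_nonneg d.1]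
    · have := mul_self_pos.2 h1
      nlinarith [mul_self_nonneg d.2]
  obtain ⟨a₁, ha₁, hmin⟩ := exists_min_image P (fun a => a.1 * d.1 + a.2 * d.2) hfin hne
  obtain ⟨a₃, ha₃, hmax⟩ := exists_max_image P (fun a => a.1 * d.1 + a.2 * d.2) hfin hne
  have line : ∀ a ∈ P, ∀ b ∈ P, a.1 * d.1 + a.2 * d.2 ≤ b.1 * d.1 + b.2 * d.2 → b ≠ a →
      ∃ j : ℤ, 0 < j ∧ b.1 - a.1 = j * d.1 ∧ b.2 - a.2 = j * d.2 := by
    rintro a ⟨_, _, _, _, ha⟩ b ⟨_, _, _, _, hb⟩ hab hne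
    obtain ⟨j, h1, h2⟩ := exists_eq_mul_of_wedge_eq_zero (e := (b.1 - a.1, b.2 - a.2)) hd
      (by simp only; linear_combination hb - ha)
    simp only at h1 h2
    refine ⟨j, ?_, h1, h2⟩
    have hj : 0 ≤ j * (d.1 * d.1 + d.2 * d.2) := by
      have : j * (d.1 * d.1 + d.2 * d.2) =
          b.1 * d.1 + b.2 * d.2 - (a.1 * d.1 + a.2 * d.2) := by
        linear_combination (-d.1) * h1 - d.2 * h2
      rw [this]; exact sub_nonneg.2 hab
    refine lt_of_le_of_ne (nonneg_of_mul_nonneg_left hj hnorm) ?_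
    rintro rfl
    exact hne (Prod.ext (by linarith) (by linarith))
  refine (measure_mono (t := S a₁ (round (A.F a₁ z)) ∪ S a₃ (round (A.F a₃ z))) ?_).trans
    ((measure_union_le _ _).trans ?_)
  · rintro x ⟨⟨a, p, hx, hxz, hℓ⟩, hR⟩
    have hp := h.round_eq hx hz hr hxz
    have ha : a ∈ P := ⟨p, x, hx, hxz, hℓ⟩
    by_cases h1 : a = a₁
    · left; rw [← h1, hp]; exact hx
    by_cases h3 : a = a₃
    · right; rw [← h3, hp]; exact hx
    refine absurd ?_ hR
    obtain ⟨j, hj, e₁, e₁'⟩ := line a₁ ha₁ a ha (hmin a ha) h1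
    obtain ⟨i, hi, e₃, e₃'⟩ := line a ha a₃ ha₃ (hmax a ha) (Ne.symm h3)
    obtain ⟨p₁, x₁, hx₁, hx₁z, -⟩ := ha₁
    obtain ⟨p₃, x₃, hx₃, hx₃z, -⟩ := ha₃
    exact ⟨h.mem_J hx, k, hkm, d, hk, A.abs_hom_le_of_between hj hi hd0 e₁ e₁' e₃ e₃' (h.shell hx₁)
      (h.shell hx) (h.shell hx₃) (h.curved hx₁) (h.curved hx₃) hz (h.mem_J hx₁) (h.mem_J hx)
      (h.mem_J hx₃) hx₁z hxz hx₃z (h.close hx₁) (h.close hx) (h.close hx₃) (h.slope hx₁)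
      (h.slope hx) (h.slope hx₃) h.hη h.hη1 h.hδη h.hδ hr⟩
  · rw [two_mul, ENNReal.ofReal_add hB0 hB0]
    exact add_le_add (hB _ _) (hB _ _)

lemma Scale.hcontent_le {s : ℝ} {hs : 0 < s} (hs1 : s ≤ 1) (h : A.Scale t δ η S) {B : ℝ}
    (hB0 : 0 ≤ B) (hB : ∀ a p, hcontent s hs (S a p) ≤ ENNReal.ofReal B) {q : ℕ}
    (hq : ((2 : ℝ) ^ q) ^ 2 ≤ 2 ^ t) :
    hcontent s hs (⋃ a, ⋃ p, S a p) ≤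
      ENNReal.ofReal (25 * ((2 + 60 * A.C / A.c) * η / A.c) ^ s * ((2 : ℝ) ^ (q + 2)) ^ (2 - s)) +
      ENNReal.ofReal ((200 * A.C * 2 ^ t) * ((17 * A.C / A.c * (2 ^ t / 2 ^ q)) * (2 * B))) := by
  classical
  have hc := A.hc
  have hC := A.hC
  have hη := h.hη
  have hq1 : (1 : ℝ) ≤ 2 ^ q := one_le_pow₀ (by norm_num)
  have ht : (1 : ℝ) ≤ 2 ^ t := one_le_pow₀ (by norm_num)
  set r : ℝ := 1 / (100 * A.C * 2 ^ t) with hrdef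
  have hr0 : 0 < r := by positivity
  have hr : 100 * A.C * 2 ^ t * r ≤ 1 := by rw [hrdef]; field_simp; rfl
  set N : ℕ := ⌊1 / r⌋₊ + 1 with hN
  have hN' : (N : ℝ) ≤ 200 * A.C * 2 ^ t := by
    have h1 : (⌊1 / r⌋₊ : ℝ) ≤ 1 / r := Nat.floor_le (by positivity)
    have h2 : 1 / r = 100 * A.C * 2 ^ t := by rw [hrdef, one_div_one_div]
    have h3 : (1 : ℝ) * 1 ≤ A.C * 2 ^ t := by gcongr
    rw [hN]; push_cast; linarith
  have dir : ∀ z, ∃ d : ℤ × ℤ, z ∈ A.J → (IsCoprime d.1 d.2 ∧ (∃ k < q + 2, Shell k d) ∧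
      |(d.1 : ℝ)| ≤ 2 * 2 ^ q ∧ |(d.2 : ℝ)| ≤ 2 * 2 ^ q ∧
      |d.1 * A.d₁ z + d.2 * A.d₂ z| ≤ A.C / 2 ^ q) := by
    intro z
    by_cases hz : z ∈ A.J
    · obtain ⟨d, hd⟩ := A.exists_coprime_abs_hom_le q hz
      exact ⟨d, fun _ => hd⟩
    · exact ⟨0, fun h => absurd h hz⟩
  choose D hD using dir
  set R := A.Rich (q + 2) ((2 + 60 * A.C / A.c) * η) with hR
  set M : ℝ := 8 * A.C / A.c * (2 ^ t / 2 ^ q) with hM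
  have hM0 : 0 ≤ M := by positivity
  have hM' : 2 * M + 1 ≤ 17 * A.C / A.c * (2 ^ t / 2 ^ q) := by
    have h1 : (1 : ℝ) ≤ 2 ^ t / 2 ^ q := by
      rw [le_div_iff₀ (by positivity)]; nlinarith
    have h2 : 1 ≤ A.C / A.c := by rw [le_div_iff₀ hc]; linarith [A.hc1]
    have h3 : 1 * 1 ≤ A.C / A.c * (2 ^ t / 2 ^ q) := by gcongr
    rw [hM, mul_div_assoc, mul_div_assoc]; linarith
  set X : ℝ → ℤ → Set ℝ := fun z ℓ =>
    {x | ∃ a p, x ∈ S a p ∧ |x - z| ≤ r ∧ a.1 * (D z).2 - a.2 * (D z).1 = ℓ} with hX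
  set z : ℕ → ℝ := fun i => A.u + i * r with hz
  have cover : (⋃ a, ⋃ p, S a p) ⊆ R ∪ ⋃ i ∈ (Finset.range N).filter (fun i => z i ∈ A.J),
      ⋃ ℓ ∈ Finset.Icc ⌈0 - M⌉ ⌊0 + M⌋, X (z i) ℓ \ R := by
    intro x hx
    simp only [mem_iUnion] at hx
    obtain ⟨a, p, hx⟩ := hx
    by_cases hxR : x ∈ R
    · exact Or.inl hxR
    right
    have hxJ := h.mem_J hx
    have hxu : 0 ≤ x - A.u := sub_nonneg.2 hxJ.1
    have f1 : (⌊(x - A.u) / r⌋₊ : ℝ) ≤ (x - A.u) / r := Nat.floor_le (by positivity)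
    have f2 := Nat.lt_floor_add_one ((x - A.u) / r)
    rw [le_div_iff₀ hr0] at f1
    rw [div_lt_iff₀ hr0] at f2
    have hzJ : z ⌊(x - A.u) / r⌋₊ ∈ A.J := by
      refine ⟨by simp only [hz]; linarith [show 0 ≤ (⌊(x - A.u) / r⌋₊ : ℝ) * r by positivity], ?_⟩
      simp only [hz]; linarith [hxJ.2]
    have hxz : |x - z ⌊(x - A.u) / r⌋₊| ≤ r := by
      simp only [hz]
      rw [abs_le]; constructor <;> linarith
    have hlt : ⌊(x - A.u) / r⌋₊ < N := by
      rw [hN, Nat.lt_succ_iff]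
      apply Nat.floor_le_floor
      gcongr
      linarith [hxJ.2, A.hlen]
    obtain ⟨hcop, hk, hd₁, hd₂, hhom⟩ := hD _ hzJ
    have hw := A.abs_wedge_le (h.shell hx) hq hd₁ hd₂ hzJ hhom (h.abs_G_le_two hx hzJ hr hxz)
    simp only [mem_iUnion, Finset.mem_filter, Finset.mem_range, Finset.mem_Icc, exists_prop]
    refine ⟨_, ⟨hlt, hzJ⟩, a.1 * (D (z ⌊(x - A.u) / r⌋₊)).2 - a.2 * (D (z ⌊(x - A.u) / r⌋₊)).1,
      ?_, ⟨a, p, hx, hxz, rfl⟩, hxR⟩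
    have := abs_le.1 hw
    constructor
    · rw [Int.ceil_le]; push_cast; linarith
    · rw [Int.le_floor]; push_cast; linarith
  refine (measure_mono cover).trans ((measure_union_le _ _).trans (add_le_add ?_ ?_))
  · exact A.hcontent_rich_le hs1 (q + 2) (by positivity)
  · refine hcontent_biUnion_le _ _ (by positivity) ?_ fun i hi => ?_
    · refine le_trans ?_ hN'
      have := Finset.card_filter_le (Finset.range N) (fun i => z i ∈ A.J)
      rw [Finset.card_range] at this
      exact_mod_cast this
    · have hzJ := (Finset.mem_filter.1 hi).2
      refine hcontent_biUnion_le _ _ (by positivity) ((int_card_le hM0).trans hM') fun ℓ _ => ?_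
      obtain ⟨hcop, hk, -⟩ := hD _ hzJ
      exact h.hcontent_line_le hB0 hB hzJ hr hcop hk ℓ

end Arc

lemma decay_of_add_le {s : ℝ} {hs : 0 < s} {E : ℕ → Set ℝ} {C C' κ κ' : ℝ} (hC : 0 ≤ C)
    (hC' : 0 ≤ C') (hκ : 0 < κ) (hκ' : 0 < κ')
    (h : ∀ᶠ t : ℕ in atTop, hcontent s hs (E t) ≤
      ENNReal.ofReal (C * (2 : ℝ) ^ (-κ * t)) + ENNReal.ofReal (C' * (2 : ℝ) ^ (-κ' * t))) :
    Decay s hs E := by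
  refine ⟨C + C', min κ κ', lt_min hκ hκ', h.mono fun t ht => ht.trans ?_⟩
  have h0 : (0 : ℝ) ≤ t := Nat.cast_nonneg t
  have h1 : -κ ≤ -min κ κ' := neg_le_neg (min_le_left κ κ')
  have h2 : -κ' ≤ -min κ κ' := neg_le_neg (min_le_right κ κ')
  rw [add_mul, ENNReal.ofReal_add (by positivity) (by positivity)]
  refine add_le_add (ENNReal.ofReal_le_ofReal ?_) (ENNReal.ofReal_le_ofReal ?_) <;>
  · gcongr
    norm_num

lemma Arc.decay_of_scale (A : Arc) {s : ℝ} {hs : 0 < s} (hs1 : s ≤ 1) {v α μ γ B : ℝ}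
    (hγ0 : 0 ≤ γ) (hγ1 : γ ≤ 1 / 2) (hB : 0 ≤ B) (h₁ : 2 - γ - μ * s < 0)
    (h₂ : γ * (2 - s) - α * s < 0) {S : ℕ → ℤ × ℤ → ℤ → Set ℝ}
    (hS : ∀ᶠ t : ℕ in atTop, A.Scale t ((2 : ℝ) ^ (-v * t)) ((2 : ℝ) ^ (-α * t)) (S t))
    (hdist : ∀ t a p, ∀ x ∈ S t a p, ∀ y ∈ S t a p, |x - y| ≤ B * (2 : ℝ) ^ (-μ * t)) :
    Decay s hs (fun t => ⋃ a, ⋃ p, S t a p) := by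
  have hc := A.hc
  have hC := A.hC
  refine decay_of_add_le (κ := -(γ * (2 - s) - α * s)) (κ' := -(2 - γ - μ * s))
    (C := 25 * ((2 + 60 * A.C / A.c) / A.c) ^ s * 4 ^ (2 - s))
    (C' := 200 * A.C * (17 * A.C / A.c) * (4 * B ^ s)) (by positivity) (by positivity)
    (by linarith) (by linarith) ?_
  filter_upwards [hS] with t ht
  have h2 : (0 : ℝ) < 2 := by norm_num
  have ht0 : (0 : ℝ) ≤ t := Nat.cast_nonneg t
  set q := ⌊γ * t⌋₊ with hq
  have hq1 : (q : ℝ) ≤ γ * t := Nat.floor_le (by positivity)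
  have hq2 : γ * t < q + 1 := Nat.lt_floor_add_one _
  have e1 : (2 : ℝ) ^ q ≤ (2 : ℝ) ^ (γ * t) := by
    rw [← Real.rpow_natCast]
    exact Real.rpow_le_rpow_of_exponent_le (by norm_num) hq1
  have e2 : (2 : ℝ) ^ (γ * t) ≤ 2 * 2 ^ q := by
    rw [← Real.rpow_natCast, ← Real.rpow_one_add' (by norm_num) (by positivity)]
    exact Real.rpow_le_rpow_of_exponent_le (by norm_num) (by linarith)
  have eq : ((2 : ℝ) ^ q) ^ 2 ≤ 2 ^ t := by
    rw [← pow_mul]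
    apply pow_le_pow_right₀ (by norm_num)
    have : ((q * 2 : ℕ) : ℝ) ≤ t := by push_cast; nlinarith
    exact_mod_cast this
  refine (ht.hcontent_le hs1 (B := (B * (2 : ℝ) ^ (-μ * t)) ^ s) (by positivity)
    (fun a p => hcontent_le_of_dist hs (by positivity) (hdist t a p)) eq).trans
    (add_le_add (ENNReal.ofReal_le_ofReal ?_) (ENNReal.ofReal_le_ofReal ?_))
  · have f1 : ((2 + 60 * A.C / A.c) * (2 : ℝ) ^ (-α * t) / A.c) ^ s =
        ((2 + 60 * A.C / A.c) / A.c) ^ s * (2 : ℝ) ^ (-α * s * t) := by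
      rw [mul_div_right_comm, Real.mul_rpow (by positivity) (by positivity), ← Real.rpow_mul h2.le]
      ring_nf
    have f2 : ((2 : ℝ) ^ (q + 2)) ^ (2 - s) ≤ 4 ^ (2 - s) * (2 : ℝ) ^ (γ * (2 - s) * t) := by
      calc ((2 : ℝ) ^ (q + 2)) ^ (2 - s) = (4 * 2 ^ q) ^ (2 - s) := by rw [pow_add]; norm_num [mul_comm]
        _ ≤ (4 * (2 : ℝ) ^ (γ * t)) ^ (2 - s) := by gcongr; linarith
        _ = _ := by
          rw [Real.mul_rpow (by positivity) (by positivity), ← Real.rpow_mul h2.le]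
          ring_nf
    rw [f1]
    calc _ ≤ 25 * (((2 + 60 * A.C / A.c) / A.c) ^ s * (2 : ℝ) ^ (-α * s * t)) *
          (4 ^ (2 - s) * (2 : ℝ) ^ (γ * (2 - s) * t)) := by gcongr
      _ = 25 * ((2 + 60 * A.C / A.c) / A.c) ^ s * 4 ^ (2 - s) *
          ((2 : ℝ) ^ (-α * s * t) * (2 : ℝ) ^ (γ * (2 - s) * t)) := by ring
      _ = _ := by
          rw [← Real.rpow_add h2]
          ring_nf
  · have f1 : (B * (2 : ℝ) ^ (-μ * t)) ^ s = B ^ s * (2 : ℝ) ^ (-μ * s * t) := by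
      rw [Real.mul_rpow (by positivity) (by positivity), ← Real.rpow_mul h2.le]
      ring_nf
    have f2 : (2 : ℝ) ^ t / 2 ^ q ≤ 2 * (2 : ℝ) ^ (t - γ * t) := by
      rw [div_le_iff₀ (by positivity), Real.rpow_sub h2, Real.rpow_natCast]
      calc (2 : ℝ) ^ t = 2 ^ t / (2 : ℝ) ^ (γ * t) * (2 : ℝ) ^ (γ * t) := by field_simp
        _ ≤ 2 ^ t / (2 : ℝ) ^ (γ * t) * (2 * 2 ^ q) := by gcongr
        _ = _ := by ring
    rw [f1]
    calc _ ≤ (200 * A.C * 2 ^ t) * ((17 * A.C / A.c * (2 * (2 : ℝ) ^ (t - γ * t))) *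
          (2 * (B ^ s * (2 : ℝ) ^ (-μ * s * t)))) := by gcongr
      _ = 200 * A.C * (17 * A.C / A.c) * (4 * B ^ s) *
          ((2 : ℝ) ^ (t : ℝ) * (2 : ℝ) ^ (t - γ * t) * (2 : ℝ) ^ (-μ * s * t)) := by
          rw [Real.rpow_natCast]; ring
      _ = _ := by
          rw [← Real.rpow_add h2, ← Real.rpow_add h2]
          ring_nf

/-- Decay for families of curved forms with small slope, under the two conditions on the exponents
that make an admissible Dirichlet parameter exist. -/
lemma Arc.decay_flat (A : Arc) {s : ℝ} {hs : 0 < s} (hs1 : s ≤ 1) {v α μ B : ℝ}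
    (hα : 0 < α) (hαv : α ≤ (v - 1) / 2) (hB : 0 ≤ B) (h₁ : 3 / 2 < μ * s)
    (h₂ : (2 - μ * s) * (2 - s) < α * s) {S : ℕ → ℤ × ℤ → ℤ → Set ℝ}
    (hS : ∀ t a p, ∀ x ∈ S t a p, x ∈ A.J ∧ Shell t a ∧ A.Curved t a ∧
      |A.F a x - p| < (2 : ℝ) ^ (-v * t) ∧ |A.G a x| ≤ (2 : ℝ) ^ (-α * t))
    (hdist : ∀ t a p, ∀ x ∈ S t a p, ∀ y ∈ S t a p, |x - y| ≤ B * (2 : ℝ) ^ (-μ * t)) :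
    Decay s hs (fun t => ⋃ a, ⋃ p, S t a p) := by
  have hs2 : 0 < 2 - s := by linarith
  have hαs : 0 < α * s / (2 - s) := by positivity
  obtain ⟨γ, hγ1, hγ2⟩ : ∃ γ, max 0 (2 - μ * s) < γ ∧ γ < min (1 / 2) (α * s / (2 - s)) := by
    refine exists_between (max_lt (lt_min (by norm_num) hαs) (lt_min (by linarith) ?_))
    rwa [lt_div_iff₀ hs2]
  obtain ⟨hγ0, hγμ⟩ := max_lt_iff.1 hγ1
  obtain ⟨hγh, hγα⟩ := lt_min_iff.1 hγ2
  rw [lt_div_iff₀ hs2] at hγα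
  refine A.decay_of_scale hs1 hγ0.le hγh.le hB (by linarith) (by linarith) (v := v) (α := α) ?_ hdist
  have hlim : Tendsto (fun t : ℕ => (v - 1) * t) atTop atTop :=
    tendsto_natCast_atTop_atTop.const_mul_atTop (by linarith)
  filter_upwards [hlim.eventually_ge_atTop 4] with t ht
  have h2 : (0 : ℝ) < 2 := by norm_num
  have ht0 : (0 : ℝ) ≤ t := Nat.cast_nonneg t
  have e : (2 : ℝ) ^ (-v * t) * 2 ^ t = (2 : ℝ) ^ (-((v - 1) * t)) := by
    rw [← Real.rpow_natCast, ← Real.rpow_add h2]; ring_nf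
  refine ⟨by positivity, Real.rpow_le_one_of_one_le_of_nonpos (by norm_num) ?_, ?_, ?_,
    fun h => (hS _ _ _ _ h).1, fun h => (hS _ _ _ _ h).2.1, fun h => (hS _ _ _ _ h).2.2.1,
    fun h => (hS _ _ _ _ h).2.2.2.1.le, fun h => (hS _ _ _ _ h).2.2.2.2⟩
  · nlinarith
  · rw [e, ← Real.rpow_natCast, ← Real.rpow_mul h2.le]
    refine Real.rpow_le_rpow_of_exponent_le (by norm_num) ?_
    push_cast
    nlinarith
  · rw [e]
    calc (2 : ℝ) ^ (-((v - 1) * t)) ≤ (2 : ℝ) ^ (-4 : ℝ) :=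
          Real.rpow_le_rpow_of_exponent_le (by norm_num) (by linarith)
      _ = 1 / 16 := by
          rw [Real.rpow_neg h2.le]; norm_num

lemma exists_between_consecutive (f : ℕ → ℝ) {y : ℝ} (h0 : f 0 ≤ y) :
    ∀ K : ℕ, y < f K → ∃ k < K, f k ≤ y ∧ y < f (k + 1)
  | 0, h => absurd h0 (not_le.2 h)
  | K + 1, h => by
    rcases lt_or_ge y (f K) with h1 | h1
    · obtain ⟨k, hk, h2⟩ := exists_between_consecutive f h0 K h1
      exact ⟨k, by omega, h2⟩
    · exact ⟨K, by omega, h1, h⟩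

namespace Arc

variable (A : Arc)

variable {A} in
lemma Curved.monotoneOn_G {t : ℕ} {a : ℤ × ℤ} (h : A.Curved t a) : MonotoneOn (A.G a) A.J := by
  intro x hx y hy hxy
  have hc := A.hc
  have := mul_sub_le_of_le_deriv A.ordConnected_J (fun z hz => A.hasDerivAt_G a hz) h hx hy hxy
  have h2 : 0 ≤ A.c * 2 ^ t * (y - x) := mul_nonneg (by positivity) (by linarith)
  linarith

variable {A} in
lemma Curved.ordConnected {t : ℕ} {a : ℤ × ℤ} (h : A.Curved t a) {U : Set ℝ}
    (hU : U.OrdConnected) : {x ∈ A.J | A.G a x ∈ U}.OrdConnected := by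
  refine ⟨fun x hx y hy z hz => ?_⟩
  have hzJ : z ∈ A.J := A.ordConnected_J.out hx.1 hy.1 hz
  exact ⟨hzJ, hU.out hx.2 hy.2 ⟨h.monotoneOn_G hx.1 hzJ hz.1, h.monotoneOn_G hzJ hy.1 hz.2⟩⟩

variable {A} in
lemma Curved.ordConnected_band {t : ℕ} {a : ℤ × ℤ} (h : A.Curved t a) {sg : ℝ}
    (hsg : sg = 1 ∨ sg = -1) (y y' : ℝ) :
    {x ∈ A.J | y ≤ sg * A.G a x ∧ sg * A.G a x < y'}.OrdConnected := by
  rcases hsg with rfl | rfl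
  · simpa only [one_mul] using! h.ordConnected (ordConnected_Ico (a := y) (b := y'))
  · convert h.ordConnected ((ordConnected_Ioc : (Ioc (-y') (-y)).OrdConnected)) using 1
    ext x
    simp only [mem_ofPred_eq, mem_Ioc, neg_one_mul]
    constructor <;> rintro ⟨h1, h2, h3⟩ <;> exact ⟨h1, by linarith, by linarith⟩

variable {A} in
lemma Curved.dist_le {t : ℕ} {a : ℤ × ℤ} (h : A.Curved t a) {η : ℝ} {x y : ℝ} (hx : x ∈ A.J)
    (hy : y ∈ A.J) (gx : |A.G a x| ≤ η) (gy : |A.G a y| ≤ η) :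
    |x - y| ≤ 2 * η / (A.c * 2 ^ t) := by
  have hc := A.hc
  have h1 := mul_abs_sub_le_of_le_deriv A.ordConnected_J (fun z hz => A.hasDerivAt_G a hz) h hx hy
  have h2 := abs_sub (A.G a x) (A.G a y)
  rw [le_div_iff₀ (by positivity)]
  linarith

lemma decay_signed {s : ℝ} {hs : 0 < s} {v β ω c V sg : ℝ} (hsg : sg = 1 ∨ sg = -1) (hv : 0 < v)
    (hω : 0 ≤ ω) (hc : 0 < c) (hV : 0 ≤ V) (hexp : 2 + ω < (v + β) * s) (T : ℕ → ℤ × ℤ → Set ℝ)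
    (hTJ : ∀ t a, T t a ⊆ A.J) (hT : ∀ t a, Shell t a → (T t a).OrdConnected)
    (hlow : ∀ t a, Shell t a → ∀ x ∈ T t a, c * (2 : ℝ) ^ (β * t) ≤ sg * A.G a x)
    (hvar : ∀ t a, Shell t a → ∀ x ∈ T t a, ∀ x' ∈ T t a,
      |A.F a x - A.F a x'| ≤ V * (2 : ℝ) ^ (ω * t)) :
    Decay s hs (fun t => {x | ∃ a, Shell t a ∧ x ∈ T t a ∧
      ∃ p : ℤ, |A.F a x - p| < (2 : ℝ) ^ (-v * t)}) := by
  have habs : |sg| = 1 := by rcases hsg with rfl | rfl <;> simp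
  refine (decay_pieces (hs := hs) hv hω hc hV hexp (fun a x => sg * A.F a x)
    (fun a x => sg * A.G a x) T hT (fun t a _ x hx => (A.hasDerivAt_F a (hTJ t a hx)).const_mul sg)
    hlow fun t a ha x hx x' hx' => ?_).mono (Eventually.of_forall fun t => ?_)
  · rw [← mul_sub, abs_mul, habs, one_mul]
    exact hvar t a ha x hx x' hx'
  · rintro x ⟨a, ha, hx, p, hp⟩
    refine ⟨a, ha, hx, ?_⟩
    rcases hsg with rfl | rfl
    · exact ⟨p, by simpa using hp⟩
    · refine ⟨-p, ?_⟩
      have : -1 * A.F a x - ((-p : ℤ) : ℝ) = -(A.F a x - p) := by push_cast; ring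
      rw [this, abs_neg]
      exact hp

/-- Decay for forms whose slope is comparable to the height. -/
lemma decay_big {s : ℝ} {hs : 0 < s} {v sg : ℝ} (hsg : sg = 1 ∨ sg = -1) (hv : 0 < v)
    (hσ : 3 < (v + 1) * s) :
    Decay s hs (fun t => {x | ∃ a, Shell t a ∧ x ∈ {x ∈ A.J |
      ((∀ y ∈ A.J, A.c * 2 ^ t ≤ sg * A.G a y) ∨ A.Curved t a) ∧ A.c * 2 ^ t ≤ sg * A.G a x} ∧
      ∃ p : ℤ, |A.F a x - p| < (2 : ℝ) ^ (-v * t)}) := by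
  have hC := A.hC
  refine A.decay_signed (β := 1) (ω := 1) (V := 5 * A.C) hsg hv zero_le_one A.hc (by positivity)
    (by linarith) (fun t a => {x ∈ A.J |
      ((∀ y ∈ A.J, A.c * 2 ^ t ≤ sg * A.G a y) ∨ A.Curved t a) ∧ A.c * 2 ^ t ≤ sg * A.G a x})
    (fun t a x hx => hx.1) (fun t a ha => ?_) (fun t a ha x hx => ?_)
    (fun t a ha x hx x' hx' => ?_)
  · refine ⟨fun x hx y hy z hz => ?_⟩
    have hzJ : z ∈ A.J := A.ordConnected_J.out hx.1 hy.1 hz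
    refine ⟨hzJ, hx.2.1, ?_⟩
    rcases hx.2.1 with h | h
    · exact h z hzJ
    · have h1 := h.monotoneOn_G hx.1 hzJ hz.1
      have h2 := h.monotoneOn_G hzJ hy.1 hz.2
      have h3 := hx.2.2
      have h4 := hy.2.2
      rcases hsg with rfl | rfl <;> linarith
  · rw [one_mul, Real.rpow_natCast]
    exact hx.2.2
  · rw [one_mul, Real.rpow_natCast]
    refine (abs_sub_le_of_abs_deriv_le A.ordConnected_J (fun z hz => A.hasDerivAt_F a hz)
      (fun z hz => A.abs_G_le ha hz) hx.1 hx'.1).trans (mul_le_of_le_one_right (by positivity) ?_)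
    have h1 := hx.1.1
    have h2 := hx.1.2
    have h3 := hx'.1.1
    have h4 := hx'.1.2
    have := A.hlen
    rw [abs_le]; constructor <;> linarith

/-- Decay for curved forms whose slope is in a dyadic band. -/
lemma decay_band {s : ℝ} {hs : 0 < s} (hs1 : s < 1) {v β ε sg : ℝ} (hsg : sg = 1 ∨ sg = -1)
    (hv : 1 < v) (hε : 0 < ε) (hσ : 3 + 4 * ε ≤ (v + 1) * s) (hβ : -((v - 1) / 2) ≤ β)
    (hβε : β + ε ≤ 1) :
    Decay s hs (fun t => {x | ∃ a, Shell t a ∧ x ∈ {x ∈ A.J | A.Curved t a ∧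
      (2 : ℝ) ^ (β * t) ≤ sg * A.G a x ∧ sg * A.G a x < (2 : ℝ) ^ ((β + ε) * t)} ∧
      ∃ p : ℤ, |A.F a x - p| < (2 : ℝ) ^ (-v * t)}) := by
  have hc := A.hc
  have h2 : (0 : ℝ) < 2 := by norm_num
  have hband : ∀ {t : ℕ} {a : ℤ × ℤ} {x : ℝ}, (2 : ℝ) ^ (β * t) ≤ sg * A.G a x →
      sg * A.G a x < (2 : ℝ) ^ ((β + ε) * t) → |A.G a x| ≤ (2 : ℝ) ^ ((β + ε) * t) := by
    intro t a x h h'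
    have h0 : (0 : ℝ) < (2 : ℝ) ^ (β * t) := by positivity
    rcases hsg with rfl | rfl <;> rw [abs_le] <;> constructor <;> linarith
  have hεs : ε * s ≤ ε := mul_le_of_le_one_right hε.le hs1.le
  rcases le_or_gt 0 (β + ε) with h0 | h0
  · refine A.decay_signed (β := β) (ω := max 0 (2 * (β + ε) - 1)) (c := 1) (V := 2 / A.c) hsg
      (by linarith) (le_max_left _ _) one_pos (by positivity) ?_ _ (fun t a x hx => hx.1)
      (fun t a ha => ?_) (fun t a ha x hx => by rw [one_mul]; exact hx.2.2.1)
      (fun t a ha x hx x' hx' => ?_)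
    · rw [← max_add_add_left]
      refine max_lt ?_ ?_
      · have : -ε * s ≤ β * s := by gcongr; linarith
        nlinarith
      · have : (β + ε) * (2 - s) ≤ 1 * (2 - s) := by gcongr; linarith
        nlinarith
    · by_cases h : A.Curved t a
      · simpa only [h, true_and] using h.ordConnected_band hsg _ _
      · simpa only [h, false_and, and_false, ofPred_false] using ordConnected_empty
    · obtain ⟨hxJ, hcur, hx1, hx2⟩ := hx
      obtain ⟨hxJ', -, hx1', hx2'⟩ := hx'
      have hT := hcur.ordConnected_band hsg ((2 : ℝ) ^ (β * t)) ((2 : ℝ) ^ ((β + ε) * t))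
      have h3 := abs_sub_le_of_abs_deriv_le hT (fun z hz => A.hasDerivAt_F a hz.1)
        (fun z hz => hband hz.2.1 hz.2.2) ⟨hxJ, hx1, hx2⟩ ⟨hxJ', hx1', hx2'⟩
      have h4 := hcur.dist_le hxJ hxJ' (hband hx1 hx2) (hband hx1' hx2')
      refine h3.trans ?_
      calc (2 : ℝ) ^ ((β + ε) * t) * |x - x'|
          ≤ (2 : ℝ) ^ ((β + ε) * t) * (2 * (2 : ℝ) ^ ((β + ε) * t) / (A.c * 2 ^ t)) := by gcongr
        _ = 2 / A.c * ((2 : ℝ) ^ ((β + ε) * t) * (2 : ℝ) ^ ((β + ε) * t) / (2 : ℝ) ^ (t : ℝ)) := by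
            rw [Real.rpow_natCast]; field_simp
        _ = 2 / A.c * (2 : ℝ) ^ ((2 * (β + ε) - 1) * t) := by
            rw [← Real.rpow_add h2, ← Real.rpow_sub h2]; ring_nf
        _ ≤ _ := by
            gcongr
            · norm_num
            · exact le_max_right _ _
  · refine (A.decay_flat (hs := hs) hs1.le (v := v) (α := -(β + ε)) (μ := v + β) (B := 2)
      (S := fun t a p => {x | x ∈ A.J ∧ Shell t a ∧ A.Curved t a ∧
        |A.F a x - p| < (2 : ℝ) ^ (-v * t) ∧ (2 : ℝ) ^ (β * t) ≤ sg * A.G a x ∧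
        sg * A.G a x < (2 : ℝ) ^ ((β + ε) * t)}) (by linarith) (by linarith) h2.le ?_ ?_ ?_ ?_).mono
      (Eventually.of_forall fun t => ?_)
    · have : -((v - 1) / 2) * s ≤ β * s := by gcongr
      linarith
    · have h3 : -((v - 1) / 2) * s * (1 - s) ≤ β * s * (1 - s) := by
        gcongr
      have h4 : 0 ≤ ((v + 1) * s - (3 + 4 * ε)) * (3 - s) := mul_nonneg (by linarith) (by linarith)
      nlinarith
    · rintro t a p x ⟨hx, ha, hcur, hp, h3, h4⟩
      refine ⟨hx, ha, hcur, hp, ?_⟩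
      rw [neg_neg]
      exact hband h3 h4
    · rintro t a p x ⟨hx, ha, hcur, hp, h3, h4⟩ y ⟨hy, -, -, hp', h3', h4'⟩
      have hT := hcur.ordConnected_band hsg ((2 : ℝ) ^ (β * t)) ((2 : ℝ) ^ ((β + ε) * t))
      have h5 := mul_abs_sub_le_of_le_deriv hT
        (fun z hz => (A.hasDerivAt_F a hz.1).const_mul sg) (fun z hz => hz.2.1) ⟨hx, h3, h4⟩
        ⟨hy, h3', h4'⟩
      have habs : |sg| = 1 := by rcases hsg with rfl | rfl <;> simp
      rw [← mul_sub, abs_mul, habs, one_mul] at h5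
      have h6 : |A.F a x - A.F a y| ≤ 2 * (2 : ℝ) ^ (-v * t) := by
        have := abs_lt.1 hp
        have := abs_lt.1 hp'
        rw [abs_le]; constructor <;> linarith
      have e : (2 : ℝ) ^ (-(v + β) * t) = (2 : ℝ) ^ (-v * t) / (2 : ℝ) ^ (β * t) := by
        rw [← Real.rpow_sub h2]; ring_nf
      rw [e, ← mul_div_assoc, le_div_iff₀ (by positivity)]
      linarith
    · rintro x ⟨a, ha, ⟨hx, hcur, h3, h4⟩, p, hp⟩
      simp only [mem_iUnion]
      exact ⟨a, p, hx, ha, hcur, hp, h3, h4⟩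

/-- Decay for curved forms with the smallest slopes. -/
lemma decay_bottom {s : ℝ} {hs : 0 < s} (hs1 : s < 1) {v : ℝ} (hv : 1 < v)
    (hσ : 3 < (v + 1) * s) :
    Decay s hs (fun t => {x | ∃ a, Shell t a ∧ x ∈ {x ∈ A.J | A.Curved t a ∧
      |A.G a x| ≤ (2 : ℝ) ^ (-((v - 1) / 2) * t)} ∧
      ∃ p : ℤ, |A.F a x - p| < (2 : ℝ) ^ (-v * t)}) := by
  have hc := A.hc
  have h2 : (0 : ℝ) < 2 := by norm_num
  refine (A.decay_flat (hs := hs) hs1.le (v := v) (α := (v - 1) / 2) (μ := (v + 1) / 2)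
    (B := 2 / A.c) (S := fun t a p => {x | x ∈ A.J ∧ Shell t a ∧ A.Curved t a ∧
      |A.F a x - p| < (2 : ℝ) ^ (-v * t) ∧ |A.G a x| ≤ (2 : ℝ) ^ (-((v - 1) / 2) * t)})
    (by linarith) le_rfl (by positivity) (by linarith) ?_ (fun t a p x hx => hx) ?_).mono
    (Eventually.of_forall fun t => ?_)
  · have : 0 < ((v + 1) * s - 3) * (3 - s) := mul_pos (by linarith) (by linarith)
    nlinarith
  · rintro t a p x ⟨hx, ha, hcur, hp, h3⟩ y ⟨hy, -, -, hp', h3'⟩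
    refine (hcur.dist_le hx hy h3 h3').trans_eq ?_
    rw [show -((v + 1) / 2) * t = -((v - 1) / 2) * t - (t : ℝ) by ring, Real.rpow_sub h2,
      Real.rpow_natCast]
    field_simp
  · rintro x ⟨a, ha, ⟨hx, hcur, h3⟩, p, hp⟩
    simp only [mem_iUnion]
    exact ⟨a, p, hx, ha, hcur, hp, h3⟩

lemma decay_half {s : ℝ} {hs : 0 < s} (hs1 : s < 1) {v : ℝ} (hv : 1 < v)
    (hσ : 3 < (v + 1) * s) :
    Decay s hs (fun t => {x ∈ A.J | ∃ a, Shell t a ∧ (A.Steep t a ∨ A.Curved t a) ∧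
      ∃ p : ℤ, |A.F a x - p| < (2 : ℝ) ^ (-v * t)}) := by
  have hc := A.hc
  obtain ⟨K, hK⟩ := exists_nat_gt (2 * (v + 1) / ((v + 1) * s - 3))
  have hK0 : (0 : ℝ) < K :=
    lt_trans (div_pos (by linarith) (by linarith)) hK
  set ε : ℝ := (v + 1) / (2 * K) with hε
  have hε0 : 0 < ε := div_pos (by linarith) (by linarith)
  have hKε : K * ε = (v + 1) / 2 := by rw [hε]; field_simp
  have hσ' : 3 + 4 * ε ≤ (v + 1) * s := by
    rw [div_lt_iff₀ (by linarith)] at hK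
    have : 4 * ε ≤ (v + 1) * s - 3 := by
      rw [hε, mul_div_assoc', div_le_iff₀ (by linarith)]
      linarith
    linarith
  set β : ℕ → ℝ := fun k => -((v - 1) / 2) + k * ε with hβ
  have hβK : β K = 1 := by simp only [hβ]; rw [hKε]; ring
  have hβs : ∀ k, β (k + 1) = β k + ε := fun k => by simp only [hβ]; push_cast; ring
  have hβ0 : ∀ k, -((v - 1) / 2) ≤ β k := fun k => by
    simp only [hβ]
    have : 0 ≤ (k : ℝ) * ε := by positivity
    linarith
  have hβ1 : ∀ k < K, β k + ε ≤ 1 := fun k hk => by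
    rw [← hβs, ← hβK]
    simp only [hβ]
    have : ((k + 1 : ℕ) : ℝ) ≤ K := by exact_mod_cast hk
    gcongr
  have band : ∀ sg : ℝ, sg = 1 ∨ sg = -1 → _ := fun sg hsg =>
    Decay.biUnion_range (s := s) (hs := hs) K fun k hk =>
      A.decay_band hs1 hsg hv hε0 hσ' (hβ0 k) (hβ1 k hk)
  refine ((((A.decay_big (Or.inl rfl) (by linarith) hσ).union
    (A.decay_big (Or.inr rfl) (by linarith) hσ)).union
    ((band 1 (Or.inl rfl)).union (band (-1) (Or.inr rfl)))).union
    (A.decay_bottom hs1 hv hσ)).mono (Eventually.of_forall fun t => ?_)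
  rintro x ⟨hx, a, ha, hsc, hp⟩
  by_cases hcur : A.Curved t a
  · rcases le_or_gt |A.G a x| ((2 : ℝ) ^ (-((v - 1) / 2) * t)) with hbot | hbot
    · exact Or.inr ⟨a, ha, ⟨hx, hcur, hbot⟩, hp⟩
    left
    obtain ⟨sg, hsg, hG⟩ : ∃ sg : ℝ, (sg = 1 ∨ sg = -1) ∧ |A.G a x| = sg * A.G a x := by
      rcases abs_choice (A.G a x) with h | h
      · exact ⟨1, Or.inl rfl, by rw [h, one_mul]⟩
      · exact ⟨-1, Or.inr rfl, by rw [h, neg_one_mul]⟩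
    rw [hG] at hbot
    rcases le_or_gt (A.c * 2 ^ t) (sg * A.G a x) with hbig | hbig
    · left
      rcases hsg with rfl | rfl
      · exact Or.inl ⟨a, ha, ⟨hx, Or.inr hcur, hbig⟩, hp⟩
      · exact Or.inr ⟨a, ha, ⟨hx, Or.inr hcur, hbig⟩, hp⟩
    · right
      obtain ⟨k, hk, h1, h2⟩ := exists_between_consecutive (fun k => (2 : ℝ) ^ (β k * t))
        (y := sg * A.G a x) (by simpa [hβ] using hbot.le) K (by
          rw [hβK, one_mul, Real.rpow_natCast]
          exact hbig.trans_le (mul_le_of_le_one_left (by positivity) A.hc1))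
      rw [hβs] at h2
      rcases hsg with rfl | rfl
      · left
        simp only [mem_iUnion]
        exact ⟨k, hk, a, ha, ⟨hx, hcur, h1, h2⟩, hp⟩
      · right
        simp only [mem_iUnion]
        exact ⟨k, hk, a, ha, ⟨hx, hcur, h1, h2⟩, hp⟩
  · have hst : A.Steep t a := hsc.resolve_right hcur
    refine Or.inl (Or.inl (Or.inl ⟨a, ha, ⟨hx, Or.inl fun y hy => ?_, ?_⟩, hp⟩))
    · rw [one_mul]; exact hst y hy
    · rw [one_mul]; exact hst x hx

/-- The points of the arc at which infinitely many forms are close to integers. -/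
lemma dimH_le {s : ℝ} (hs : 0 < s) (hs1 : s < 1) {v : ℝ} (hv : 1 < v) (hσ : 3 < (v + 1) * s) :
    dimH {x ∈ A.J | ∃ᶠ t : ℕ in atTop, ∃ a, Shell t a ∧
      ∃ p : ℤ, |A.F a x - p| < (2 : ℝ) ^ (-v * t)} ≤ ENNReal.ofReal s := by
  have hc := A.hc
  have D := (A.decay_half (hs := hs) hs1 hv hσ).union (A.neg.decay_half (hs := hs) hs1 hv hσ)
  refine (dimH_mono ?_).trans D.dimH_le
  rintro x ⟨hx, hfr⟩
  have hlim : Tendsto (fun t : ℕ => A.c * (2 : ℝ) ^ t) atTop atTop :=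
    (tendsto_pow_atTop_atTop_of_one_lt (by norm_num)).const_mul_atTop hc
  refine ((hlim.eventually_ge_atTop A.C).and_frequently hfr).mono ?_
  rintro t ⟨ht, a, ha, p, hp⟩
  rcases A.steep_or_curved ht ha with h | h
  · exact Or.inl ⟨hx, a, ha, h, p, hp⟩
  · refine Or.inr ⟨hx, -a, ha.neg, h, -p, ?_⟩
    rw [F_neg]
    have : -A.F a x - ((-p : ℤ) : ℝ) = -(A.F a x - p) := by push_cast; ring
    rw [this, abs_neg]
    exact hp

end Arc

lemma regularity_of_contDiffOn_two {f : ℝ → ℝ} {a b : ℝ} (hab : a < b)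
    (hf : ContDiffOn ℝ 2 f (Icc a b)) {x : ℝ} (hx : x ∈ Ioo a b) :
    HasDerivAt f (derivWithin f (Icc a b) x) x ∧
      HasDerivAt (derivWithin f (Icc a b)) (iteratedDerivWithin 2 f (Icc a b) x) x ∧
      ContinuousAt (derivWithin f (Icc a b)) x ∧
      ContinuousAt (iteratedDerivWithin 2 f (Icc a b)) x := by
  have hu := uniqueDiffOn_Icc hab
  have hn : Icc a b ∈ nhds x := Icc_mem_nhds hx.1 hx.2
  have hxI : x ∈ Icc a b := Ioo_subset_Icc_self hx
  have h1 : ContDiffOn ℝ 1 (derivWithin f (Icc a b)) (Icc a b) :=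
    hf.derivWithin hu (by norm_num)
  have he : iteratedDerivWithin 2 f (Icc a b) =
      derivWithin (derivWithin f (Icc a b)) (Icc a b) := by
    rw [show (2 : ℕ) = 1 + 1 from rfl, iteratedDerivWithin_succ, iteratedDerivWithin_one]
  refine ⟨?_, ?_, h1.continuousOn.continuousAt hn, ?_⟩
  · exact ((hf.differentiableOn (by norm_num)) x hxI).hasDerivWithinAt.hasDerivAt hn
  · rw [he]
    exact ((h1.differentiableOn (by norm_num)) x hxI).hasDerivWithinAt.hasDerivAt hn
  · exact (hf.continuousOn_iteratedDerivWithin (by norm_num) hu).continuousAt hn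

lemma abs_combination_sub_le {a₁ a₂ p₁ p₂ q₁ q₂ c : ℝ} (h₁ : |p₁ - q₁| ≤ c)
    (h₂ : |p₂ - q₂| ≤ c) :
    |(a₁ * p₁ + a₂ * p₂) - (a₁ * q₁ + a₂ * q₂)| ≤ 2 * c * max |a₁| |a₂| := by
  have hc : 0 ≤ c := (abs_nonneg _).trans h₁
  calc |(a₁ * p₁ + a₂ * p₂) - (a₁ * q₁ + a₂ * q₂)|
      = |a₁ * (p₁ - q₁) + a₂ * (p₂ - q₂)| := by ring_nf
    _ ≤ |a₁| * |p₁ - q₁| + |a₂| * |p₂ - q₂| := by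
        rw [← abs_mul, ← abs_mul]; exact abs_add_le _ _
    _ ≤ max |a₁| |a₂| * c + max |a₁| |a₂| * c := by
        gcongr
        · exact le_max_left _ _
        · exact le_max_right _ _
    _ = 2 * c * max |a₁| |a₂| := by ring

lemma max_combination_ge {u₁ u₂ w₁ w₂ c M : ℝ} (hM : 0 < M)
    (hu : |u₁| + |u₂| + |w₁| + |w₂| ≤ M)
    (hW : 4 * c * M ≤ |u₁ * w₂ - u₂ * w₁|) (a₁ a₂ : ℝ) :
    4 * c * max |a₁| |a₂| ≤ max |a₁ * u₁ + a₂ * u₂| |a₁ * w₁ + a₂ * w₂| := by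
  set U := a₁ * u₁ + a₂ * u₂
  set V := a₁ * w₁ + a₂ * w₂
  have hU := le_max_left |U| |V|
  have hV := le_max_right |U| |V|
  have h0 : 0 ≤ max |U| |V| := (abs_nonneg _).trans hU
  have key : ∀ {y p q : ℝ}, |p| + |q| ≤ M →
      (u₁ * w₂ - u₂ * w₁) * y = U * p - V * q → 4 * c * |y| ≤ max |U| |V| := by
    intro y p q hpq h
    have h1 : |u₁ * w₂ - u₂ * w₁| * |y| ≤ max |U| |V| * M := by
      calc |u₁ * w₂ - u₂ * w₁| * |y| = |U * p - V * q| := by rw [← abs_mul, h]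
        _ ≤ |U| * |p| + |V| * |q| := by
            rw [← abs_mul, ← abs_mul]; exact abs_sub _ _
        _ ≤ max |U| |V| * |p| + max |U| |V| * |q| := by gcongr
        _ = max |U| |V| * (|p| + |q|) := by ring
        _ ≤ max |U| |V| * M := by gcongr
    have h2 := mul_le_mul_of_nonneg_right hW (abs_nonneg y)
    have h3 : 4 * c * |y| * M ≤ max |U| |V| * M := by linarith
    exact le_of_mul_le_mul_right h3 hM
  have p1 := abs_nonneg u₁
  have p2 := abs_nonneg u₂
  have p3 := abs_nonneg w₁
  have p4 := abs_nonneg w₂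
  rcases le_total |a₁| |a₂| with h | h
  · rw [max_eq_right h]
    refine key (p := -w₁) (q := -u₁) (by rw [abs_neg, abs_neg]; linarith) ?_
    simp only [U, V]; ring
  · rw [max_eq_left h]
    refine key (p := w₂) (q := u₂) (by linarith) ?_
    simp only [U, V]; ring

lemma exists_arc {f₁ f₂ l : ℝ → ℝ} {a b : ℝ} (hab : a < b)
    (hf₁ : ContDiffOn ℝ 2 f₁ (Icc a b)) (hf₂ : ContDiffOn ℝ 2 f₂ (Icc a b))
    (hl : ContDiffOn ℝ 2 l (Icc a b)) {x₀ : ℝ} (hx₀ : x₀ ∈ Ioo a b)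
    (hW : derivWithin f₁ (Icc a b) x₀ * iteratedDerivWithin 2 f₂ (Icc a b) x₀ -
      derivWithin f₂ (Icc a b) x₀ * iteratedDerivWithin 2 f₁ (Icc a b) x₀ ≠ 0) :
    ∃ A : Arc, A.f₁ = f₁ ∧ A.f₂ = f₂ ∧ A.l = l ∧ A.J ∈ nhds x₀ := by
  have r₁ := fun {x} (hx : x ∈ Ioo a b) => regularity_of_contDiffOn_two hab hf₁ hx
  have r₂ := fun {x} (hx : x ∈ Ioo a b) => regularity_of_contDiffOn_two hab hf₂ hx
  have rl := fun {x} (hx : x ∈ Ioo a b) => regularity_of_contDiffOn_two hab hl hx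
  generalize derivWithin f₁ (Icc a b) = d₁ at *
  generalize derivWithin f₂ (Icc a b) = d₂ at *
  generalize derivWithin l (Icc a b) = dl at *
  generalize iteratedDerivWithin 2 f₁ (Icc a b) = e₁ at *
  generalize iteratedDerivWithin 2 f₂ (Icc a b) = e₂ at *
  generalize iteratedDerivWithin 2 l (Icc a b) = el at *
  have n1 := abs_nonneg (d₁ x₀)
  have n2 := abs_nonneg (d₂ x₀)
  have n3 := abs_nonneg (e₁ x₀)
  have n4 := abs_nonneg (e₂ x₀)
  have n5 := abs_nonneg (dl x₀)
  have n6 := abs_nonneg (el x₀)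
  obtain ⟨M, hM⟩ : ∃ M, M = 1 + |d₁ x₀| + |d₂ x₀| + |e₁ x₀| + |e₂ x₀| + |dl x₀| + |el x₀| :=
    ⟨_, rfl⟩
  have hM0 : 0 < M := by linarith
  obtain ⟨c, hc, hc1, hcW⟩ : ∃ c : ℝ, 0 < c ∧ c ≤ 1 ∧
      4 * c * M ≤ |d₁ x₀ * e₂ x₀ - d₂ x₀ * e₁ x₀| := by
    have hWp := abs_pos.2 hW
    refine ⟨min 1 (|d₁ x₀ * e₂ x₀ - d₂ x₀ * e₁ x₀| / (4 * M)), by positivity,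
      min_le_left _ _, ?_⟩
    have := min_le_right 1 (|d₁ x₀ * e₂ x₀ - d₂ x₀ * e₁ x₀| / (4 * M))
    rw [le_div_iff₀ (by positivity)] at this
    linarith
  have hcont : ∀ {g : ℝ → ℝ}, ContinuousAt g x₀ → ∀ᶠ x in nhds x₀, |g x - g x₀| ≤ c := by
    intro g hg
    filter_upwards [Metric.tendsto_nhds.1 hg c hc] with x hx
    exact hx.le
  have hev : ∀ᶠ x in nhds x₀, x ∈ Ioo a b ∧ |d₁ x - d₁ x₀| ≤ c ∧ |d₂ x - d₂ x₀| ≤ c ∧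
      |dl x - dl x₀| ≤ c ∧ |e₁ x - e₁ x₀| ≤ c ∧ |e₂ x - e₂ x₀| ≤ c ∧ |el x - el x₀| ≤ c := by
    filter_upwards [Ioo_mem_nhds hx₀.1 hx₀.2, hcont (r₁ hx₀).2.2.1, hcont (r₂ hx₀).2.2.1,
      hcont (rl hx₀).2.2.1, hcont (r₁ hx₀).2.2.2, hcont (r₂ hx₀).2.2.2, hcont (rl hx₀).2.2.2]
      with x h0 h1 h2 h3 h4 h5 h6
    exact ⟨h0, h1, h2, h3, h4, h5, h6⟩
  obtain ⟨r, hr, hball⟩ := Metric.nhds_basis_closedBall.eventually_iff.1 hev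
  obtain ⟨ρ, hρ, hρr, hρ2⟩ : ∃ ρ : ℝ, 0 < ρ ∧ ρ ≤ r ∧ ρ ≤ 1 / 2 :=
    ⟨min r (1 / 2), by positivity, min_le_left _ _, min_le_right _ _⟩
  have H : ∀ x ∈ Icc (x₀ - ρ) (x₀ + ρ), x ∈ Ioo a b ∧ |d₁ x - d₁ x₀| ≤ c ∧
      |d₂ x - d₂ x₀| ≤ c ∧ |dl x - dl x₀| ≤ c ∧ |e₁ x - e₁ x₀| ≤ c ∧ |e₂ x - e₂ x₀| ≤ c ∧
      |el x - el x₀| ≤ c := by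
    intro x hx
    refine hball (Metric.closedBall_subset_closedBall hρr ?_)
    rwa [Real.closedBall_eq_Icc]
  have bound : ∀ {p q : ℝ}, |p - q| ≤ c → |q| + 1 ≤ M + 1 → |p| ≤ M + 1 := by
    intro p q h h'
    have := abs_sub_abs_le_abs_sub p q
    linarith
  have comb := max_combination_ge (c := c) hM0
    (show |d₁ x₀| + |d₂ x₀| + |e₁ x₀| + |e₂ x₀| ≤ M by linarith) hcW
  have lower : ∀ {p q m : ℝ}, |p - q| ≤ 2 * c * m → 4 * c * m ≤ q → 2 * c * m ≤ p := by
    intro p q m h h'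
    have := (abs_le.1 h).1
    linarith
  have upper : ∀ {p q m : ℝ}, |p - q| ≤ 2 * c * m → 4 * c * m ≤ -q → 2 * c * m ≤ -p := by
    intro p q m h h'
    have := (abs_le.1 h).2
    linarith
  have hnhds : Icc (x₀ - ρ) (x₀ + ρ) ∈ nhds x₀ := Icc_mem_nhds (by linarith) (by linarith)
  refine ⟨{ f₁ := f₁, f₂ := f₂, l := l, d₁ := d₁, d₂ := d₂, dl := dl, e₁ := e₁, e₂ := e₂,
            el := el, u := x₀ - ρ, w := x₀ + ρ, c := c, C := M + 1,
            huw := by linarith, hlen := by linarith, hc := hc, hc1 := hc1, hC := by linarith,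
            hf₁ := fun x hx => (r₁ (H x hx).1).1, hf₂ := fun x hx => (r₂ (H x hx).1).1,
            hl := fun x hx => (rl (H x hx).1).1, hd₁ := fun x hx => (r₁ (H x hx).1).2.1,
            hd₂ := fun x hx => (r₂ (H x hx).1).2.1, hdl := fun x hx => (rl (H x hx).1).2.1,
            bd₁ := fun x hx => bound (H x hx).2.1 (by linarith),
            bd₂ := fun x hx => bound (H x hx).2.2.1 (by linarith),
            bdl := fun x hx => bound (H x hx).2.2.2.1 (by linarith),
            be₁ := fun x hx => bound (H x hx).2.2.2.2.1 (by linarith),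
            be₂ := fun x hx => bound (H x hx).2.2.2.2.2.1 (by linarith),
            bel := fun x hx => bound (H x hx).2.2.2.2.2.2 (by linarith),
            nondeg := ?_, dich := ?_ }, rfl, rfl, rfl, hnhds⟩
  · intro x hx
    obtain ⟨-, h1, h2, -⟩ := H x hx
    by_contra! hcon
    have k1 := abs_sub_abs_le_abs_sub (d₁ x₀) (d₁ x)
    have k2 := abs_sub_abs_le_abs_sub (d₂ x₀) (d₂ x)
    rw [abs_sub_comm] at h1 h2
    have m1 : |d₁ x₀| < 2 * c := by linarith [hcon.1]
    have m2 : |d₂ x₀| < 2 * c := by linarith [hcon.2]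
    have hlt : |d₁ x₀ * e₂ x₀ - d₂ x₀ * e₁ x₀| ≤ 2 * c * M := by
      calc |d₁ x₀ * e₂ x₀ - d₂ x₀ * e₁ x₀| ≤ |d₁ x₀| * |e₂ x₀| + |d₂ x₀| * |e₁ x₀| := by
            rw [← abs_mul, ← abs_mul]; exact abs_sub _ _
        _ ≤ 2 * c * |e₂ x₀| + 2 * c * |e₁ x₀| := by gcongr
        _ = 2 * c * (|e₂ x₀| + |e₁ x₀|) := by ring
        _ ≤ 2 * c * M := by gcongr; linarith
    have := mul_pos hc hM0
    linarith
  · intro a₁ a₂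
    rcases le_max_iff.1 (comb a₁ a₂) with h | h
    · rcases le_abs.1 h with h | h
      · exact Or.inl fun x hx =>
          lower (abs_combination_sub_le (H x hx).2.1 (H x hx).2.2.1) h
      · exact Or.inr <| Or.inl fun x hx =>
          upper (abs_combination_sub_le (H x hx).2.1 (H x hx).2.2.1) h
    · rcases le_abs.1 h with h | h
      · exact Or.inr <| Or.inr <| Or.inl fun x hx =>
          lower (abs_combination_sub_le (H x hx).2.2.2.2.1 (H x hx).2.2.2.2.2.1) h
      · exact Or.inr <| Or.inr <| Or.inr fun x hx =>
          upper (abs_combination_sub_le (H x hx).2.2.2.2.1 (H x hx).2.2.2.2.2.1) h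

lemma frequently_shell_of_infinite {g : ℤ × ℤ → ℝ} {v : ℝ} (hv : 0 ≤ v)
    (h : {p : ℤ × ℤ | p ≠ 0 ∧
      nearestIntDist (g p) < ((max p.1.natAbs p.2.natAbs : ℕ) : ℝ) ^ (-v)}.Infinite) :
    ∃ᶠ t : ℕ in atTop, ∃ a, Shell t a ∧ ∃ p : ℤ, |g a - p| < (2 : ℝ) ^ (-v * t) := by
  intro hcon
  obtain ⟨N, hN⟩ := eventually_atTop.1 hcon
  refine h (((Finset.range N).biUnion box).finite_toSet.subset ?_)
  rintro a ⟨ha0, ha⟩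
  obtain ⟨k, hk⟩ := exists_shell ha0
  rw [Finset.mem_coe, Finset.mem_biUnion]
  refine ⟨k, Finset.mem_range.2 ?_, hk.mem_box⟩
  by_contra! hkN
  refine hN k hkN ⟨a, hk, round (g a), lt_of_lt_of_le ha ?_⟩
  have h1 : (2 : ℝ) ^ k ≤ ((max a.1.natAbs a.2.natAbs : ℕ) : ℝ) := by exact_mod_cast hk.1
  calc ((max a.1.natAbs a.2.natAbs : ℕ) : ℝ) ^ (-v) ≤ ((2 : ℝ) ^ k) ^ (-v) :=
        Real.rpow_le_rpow_of_nonpos (by positivity) h1 (by linarith)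
    _ = (2 : ℝ) ^ (-v * k) := by
        rw [← Real.rpow_natCast, ← Real.rpow_mul (by norm_num), mul_comm]

lemma Arc.dimH_le_three_div (A : Arc) {v : ℝ} (hv : 2 < v) :
    dimH {x ∈ A.J | ∃ᶠ t : ℕ in atTop, ∃ a, Shell t a ∧
      ∃ p : ℤ, |A.F a x - p| < (2 : ℝ) ^ (-v * t)} ≤ ENNReal.ofReal (3 / (v + 1)) := by
  have hlt : 3 / (v + 1) < 1 := by rw [div_lt_one (by linarith)]; linarith
  have hpos : 0 < 3 / (v + 1) := by apply div_pos <;> linarith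
  have hlim : Tendsto ENNReal.ofReal (nhdsWithin (3 / (v + 1)) (Ioi (3 / (v + 1))))
      (nhds (ENNReal.ofReal (3 / (v + 1)))) := ENNReal.continuous_ofReal.continuousWithinAt
  refine ge_of_tendsto hlim ?_
  filter_upwards [Ioo_mem_nhdsGT hlt] with s hs
  refine A.dimH_le (hpos.trans hs.1) hs.2 (by linarith) ?_
  have := hs.1
  rw [div_lt_iff₀ (by linarith)] at this
  linarith

end PlanarDual

theorem stmt_4 (a b : ℝ) (hab : a < b)
    (f₁ f₂ lam : ℝ → ℝ)
    (hf₁ : ContDiffOn ℝ 2 f₁ (Icc a b)) (hf₂ : ContDiffOn ℝ 2 f₂ (Icc a b))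
    (hlam : ContDiffOn ℝ 2 lam (Icc a b))
    (v : ℝ) (hv : 2 < v)
    (hW : dimH {x ∈ Icc a b |
        derivWithin f₁ (Icc a b) x * iteratedDerivWithin 2 f₂ (Icc a b) x -
          derivWithin f₂ (Icc a b) x * iteratedDerivWithin 2 f₁ (Icc a b) x = 0} ≤
      ENNReal.ofReal (3 / (v + 1))) :
    dimH {x ∈ Icc a b |
        {p : ℤ × ℤ | p ≠ 0 ∧
          nearestIntDist ((p.1 : ℝ) * f₁ x + (p.2 : ℝ) * f₂ x + lam x) <
            ((max p.1.natAbs p.2.natAbs : ℕ) : ℝ) ^ (-v)}.Infinite} ≤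
      ENNReal.ofReal (3 / (v + 1)) := by
  set W : ℝ → ℝ := fun x => derivWithin f₁ (Icc a b) x * iteratedDerivWithin 2 f₂ (Icc a b) x -
    derivWithin f₂ (Icc a b) x * iteratedDerivWithin 2 f₁ (Icc a b) x with hWdef
  set S : Set ℝ := {x ∈ Icc a b | {p : ℤ × ℤ | p ≠ 0 ∧
    nearestIntDist ((p.1 : ℝ) * f₁ x + (p.2 : ℝ) * f₂ x + lam x) <
      ((max p.1.natAbs p.2.natAbs : ℕ) : ℝ) ^ (-v)}.Infinite} with hS
  set G : Set ℝ := {x ∈ S | x ∈ Ioo a b ∧ W x ≠ 0} with hG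
  have hcover : S ⊆ ({x ∈ Icc a b | W x = 0} ∪ {a, b}) ∪ G := by
    intro x hx
    by_cases h0 : W x = 0
    · exact Or.inl (Or.inl ⟨hx.1, h0⟩)
    rcases eq_or_lt_of_le hx.1.1 with h1 | h1
    · exact Or.inl (Or.inr (Or.inl h1.symm))
    rcases eq_or_lt_of_le hx.1.2 with h2 | h2
    · exact Or.inl (Or.inr (Or.inr h2))
    exact Or.inr ⟨hx, ⟨h1, h2⟩, h0⟩
  refine (dimH_mono hcover).trans ?_
  rw [dimH_union, dimH_union, (Set.toFinite {a, b}).dimH_zero]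
  refine max_le (max_le hW zero_le) ?_
  by_contra! hlt
  obtain ⟨x₀, hx₀, hloc⟩ := exists_mem_nhdsWithin_lt_dimH_of_lt_dimH hlt
  obtain ⟨A, hA₁, hA₂, hA₃, hAJ⟩ := PlanarDual.exists_arc hab hf₁ hf₂ hlam hx₀.2.1 hx₀.2.2
  refine absurd (hloc (A.J ∩ G) (inter_mem (mem_nhdsWithin_of_mem_nhds hAJ) self_mem_nhdsWithin))
    (not_lt.2 ((dimH_mono ?_).trans (A.dimH_le_three_div hv)))
  rintro x ⟨hxJ, hxG⟩
  refine ⟨hxJ, ?_⟩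
  simp only [PlanarDual.Arc.F, hA₁, hA₂, hA₃]
  exact PlanarDual.frequently_shell_of_infinite
    (g := fun p => (p.1 : ℝ) * f₁ x + (p.2 : ℝ) * f₂ x + lam x) (by linarith) hxG.1.2
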